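/- Assume K has at least three elements. Let 𝒱 be an affine subspace of M_n(K) of dimension n(n-1)/2 that is included in GL_n(K). Then there exist positive integers n_1,…,n_p with n_1+⋯+n_p = n and non-isotropic matrices P_k ∈ GL_{n_k}(K) such that 𝒱 is equivalent to I_n + (P_1·Alt_{n_1}(K) ∨ ⋯ ∨ P_p·Alt_{n_p}(K)). Moreover, p is uniquely determined by 𝒱 and, for each k, the similarity class of the quadratic form X ↦ X^T P_k X is uniquely determined by 𝒱; conversely, if Q_k ∈ GL_{n_k}(K) are non-isotropic matrices such that X ↦ X^T Q_k X is similar to X ↦ X^T P_k X for each k, then 𝒱 is equivalent to I_n + (Q_1·Alt_{n_1}(K) ∨ ⋯ ∨ Q_p·Alt_{n_p}(K)). -/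

import Mathlib

open Matrix

/-- The set of alternate matrices: those `A` with `Xᵀ A X = 0` for all `X`. -/
def altSet (K : Type*) [Field K] (n : ℕ) : Set (Matrix (Fin n) (Fin n) K) :=
  {A | ∀ X : Fin n → K, X ⬝ᵥ A.mulVec X = 0}

/-- A matrix `P` is non-isotropic if `Xᵀ P X ≠ 0` for every non-zero `X`. -/
def nonIsotropic {K : Type*} [Field K] {n : ℕ} (P : Matrix (Fin n) (Fin n) K) : Prop :=
  ∀ X : Fin n → K, X ≠ 0 → X ⬝ᵥ P.mulVec X ≠ 0

/-- `V ∨ W`: block upper-triangular matrices with diagonal blocks in `V` and `W` and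
arbitrary upper-right block. -/
def blockJoin {K : Type*} [Field K] {n p : ℕ}
    (V : Set (Matrix (Fin n) (Fin n) K)) (W : Set (Matrix (Fin p) (Fin p) K)) :
    Set (Matrix (Fin (n + p)) (Fin (n + p)) K) :=
  {M | ∃ A ∈ V, ∃ C ∈ W, ∃ B : Matrix (Fin n) (Fin p) K,
    M = Matrix.reindex finSumFinEquiv finSumFinEquiv (Matrix.fromBlocks A B 0 C)}

/-- Sum of the sizes in a list of (size, matrix) pairs. -/
def sigSum {β : ℕ → Type*} : List (Σ m : ℕ, β m) → ℕ
  | [] => 0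
  | x :: xs => x.1 + sigSum xs

/-- `P_1·Alt_{n_1}(K) ∨ ⋯ ∨ P_p·Alt_{n_p}(K)` for a list of pairs `(n_k, P_k)`. -/
def bdSet {K : Type*} [Field K] :
    (l : List (Σ m : ℕ, Matrix (Fin m) (Fin m) K)) →
      Set (Matrix (Fin (sigSum l)) (Fin (sigSum l)) K)
  | [] => Set.univ
  | x :: xs => blockJoin ((fun A => x.2 * A) '' altSet K x.1) (bdSet xs)

/-- Two subsets of `M_n(K)` are equivalent if `W = P V Q` for invertible `P, Q`. -/
def EquivSets {K : Type*} [Field K] {n : ℕ}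
    (V W : Set (Matrix (Fin n) (Fin n) K)) : Prop :=
  ∃ P Q : Matrix (Fin n) (Fin n) K, IsUnit P ∧ IsUnit Q ∧ W = (fun M => P * M * Q) '' V

/-- The affine subspace `𝒱` is represented by the list `l` of pairs `(n_k, P_k)`:
the sizes are positive, each `P_k` is an invertible non-isotropic matrix, the sizes sum
to `n`, and `𝒱` is equivalent to `I_n + (P_1·Alt_{n_1}(K) ∨ ⋯ ∨ P_p·Alt_{n_p}(K))`. -/
def AffRepresents {K : Type*} [Field K] {n : ℕ} (𝒱 : Set (Matrix (Fin n) (Fin n) K))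
    (l : List (Σ m : ℕ, Matrix (Fin m) (Fin m) K)) : Prop :=
  (∀ x ∈ l, 0 < x.1 ∧ IsUnit x.2 ∧ nonIsotropic x.2) ∧
  ∃ h : sigSum l = n,
    EquivSets ((fun M => 1 + M) '' ((Matrix.reindex (finCongr h) (finCongr h)) '' bdSet l)) 𝒱

/-- Same sizes, and the associated quadratic forms `X ↦ Xᵀ P X`, `X ↦ Xᵀ Q X` are similar:
there are `λ ≠ 0` and an invertible `R` with `λ • Q - R * P * Rᵀ` alternate. -/
def qfSimilar {K : Type*} [Field K] (x y : Σ m : ℕ, Matrix (Fin m) (Fin m) K) : Prop :=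
  ∃ h : x.1 = y.1, ∃ c : K, c ≠ 0 ∧ ∃ R : Matrix (Fin x.1) (Fin x.1) K, IsUnit R ∧
    c • (Matrix.reindex (finCongr h.symm) (finCongr h.symm) y.2) - R * x.2 * Rᵀ
      ∈ altSet K x.1

namespace AffineNonsingular

open Module

section TrivialSpectrum

variable {K : Type*} [Field K] {E : Type*} [AddCommGroup E] [Module K E]

/-- A linear space of endomorphisms has trivial spectrum if none of its members has `1` (hence any
non-zero scalar) as an eigenvalue. -/
def TrivialSpectrum (V : Submodule K (End K E)) : Prop :=
  ∀ M ∈ V, ∀ x, M x = x → x = 0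

/-- A vector `x` is bad for `V` if `V` contains a non-zero endomorphism with range in `K x`. -/
def IsBad (V : Submodule K (End K E)) (x : E) : Prop :=
  ∃ f : Dual K E, f ≠ 0 ∧ f.smulRight x ∈ V

/-- In a finite digraph where each vertex has an out-neighbour, there is a non-empty set of vertices
each of which has exactly one out-neighbour in the set. -/
theorem exists_finset_unique_outNeighbour {ι : Type*} [Finite ι] [Nonempty ι]
    (r : ι → ι → Prop) (h : ∀ i, ∃ j, r i j) :
    ∃ S : Finset ι, S.Nonempty ∧ ∀ i ∈ S, ∃ j ∈ S, r i j ∧ ∀ k ∈ S, r i k → k = j := by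
  classical
  have := Fintype.ofFinite ι
  obtain ⟨S, hS⟩ := exists_minimal_of_wellFoundedLT
    (fun S : Finset ι => S.Nonempty ∧ ∀ i ∈ S, ∃ j ∈ S, r i j)
    ⟨Finset.univ, Finset.univ_nonempty, fun i _ => by simpa using h i⟩
  obtain ⟨⟨hne, hcl⟩, hmin⟩ := hS
  refine ⟨S, hne, ?_⟩
  have key : ∀ j ∈ S, ∃ i ∈ S, r i j ∧ ∀ k ∈ S, r i k → k = j := by
    intro j hj
    by_contra! hcon
    have hne' : (S.erase j).Nonempty := by
      obtain ⟨k, hk, hjk⟩ := hcl j hj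
      by_cases hkj : k = j
      · obtain ⟨k', hk', _, hk'j⟩ := hcon j hj (hkj ▸ hjk)
        exact ⟨k', by simp [hk', hk'j]⟩
      · exact ⟨k, by simp [hk, hkj]⟩
    have := @hmin (S.erase j) ⟨hne', fun i hi => ?_⟩ (Finset.erase_subset _ _)
    · exact absurd (this hj) (by simp)
    · have hiS := Finset.mem_of_mem_erase hi
      obtain ⟨k, hk, hik⟩ := hcl i hiS
      by_cases hkj : k = j
      · subst hkj
        obtain ⟨k', hk', h1, h2⟩ := hcon i hiS hik
        exact ⟨k', by simp [hk', h2], h1⟩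
      · exact ⟨k, by simp [hk, hkj], hik⟩
  choose! g hgS hgr hgu using key
  have hinj : Set.InjOn g S := by
    intro a ha b hb hab
    have := hgu a ha b hb (hab ▸ hgr b hb)
    exact this.symm
  have hsurj := Finset.surj_on_of_inj_on_of_card_le (s := S) (t := S) (fun a _ => g a)
    (fun a ha => hgS a ha) (fun a b ha hb hab => hinj ha hb hab) le_rfl
  intro i hi
  obtain ⟨j, hj, rfl⟩ := hsurj i hi
  exact ⟨j, hj, hgr j hj, hgu j hj⟩

theorem isBad_zero [Nontrivial E] (V : Submodule K (End K E)) : IsBad V 0 := by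
  obtain ⟨f, hf⟩ := exists_ne (0 : Dual K E)
  refine ⟨f, hf, ?_⟩
  convert V.zero_mem
  ext; simp

/-- The bad vectors of a space with trivial spectrum do not span the whole space. -/
theorem exists_not_isBad [FiniteDimensional K E] [Nontrivial E] {V : Submodule K (End K E)}
    (hV : TrivialSpectrum V) : ∃ z, ¬ IsBad V z := by
  by_contra! hbad
  let e := finBasis K E
  have : Nonempty (Fin (finrank K E)) := ⟨⟨0, finrank_pos⟩⟩
  choose f hf0 hfV using fun i => hbad (e i)
  obtain ⟨S, ⟨i₀, hi₀⟩, hS⟩ := exists_finset_unique_outNeighbour (fun i j => f i (e j) ≠ 0) (by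
    intro i
    by_contra! hcon
    exact hf0 i (e.ext (by simpa using hcon)))
  choose! g hgS hg hgu using hS
  have hfv : ∀ i ∈ S, f i (∑ j ∈ S, e j) = f i (e (g i)) := by
    intro i hi
    rw [map_sum]
    refine Finset.sum_eq_single _ (fun k hk hkj => ?_) (fun h => absurd (hgS i hi) h)
    by_contra hne
    exact hkj (hgu i hi k hk hne)
  have h0 : (∑ j ∈ S, e j) = 0 := by
    refine hV (∑ i ∈ S, (f i (e (g i)))⁻¹ • (f i).smulRight (e i))
      (V.sum_mem fun i _ => V.smul_mem _ (hfV i)) _ ?_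
    rw [LinearMap.sum_apply]
    refine Finset.sum_congr rfl fun i hi => ?_
    rw [LinearMap.smul_apply, LinearMap.smulRight_apply, hfv i hi, smul_smul,
      inv_mul_cancel₀ (hg i hi), one_smul]
  have := congrArg (fun v => e.repr v i₀) h0
  simp [Finsupp.single_apply, hi₀] at this

/-- The evaluation at `z` on `V`. -/
def evalAt (V : Submodule K (End K E)) (z : E) : V →ₗ[K] E :=
  (LinearMap.applyₗ z).comp V.subtype

@[simp]
theorem evalAt_apply (V : Submodule K (End K E)) (z : E) (M : V) : evalAt V z M = M.1 z := rfl

theorem exists_dual_of_ne_zero {V : Submodule K (End K E)} (hV : TrivialSpectrum V) {x : E}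
    (hx : x ≠ 0) : ∃ κ : Dual K E, κ x = 1 ∧ ∀ M ∈ V, κ (M x) = 0 := by
  have : x ∉ LinearMap.range (evalAt V x) := by
    rintro ⟨M, hM⟩
    exact hx (hV M.1 M.2 x hM)
  obtain ⟨f, hf, hle⟩ := Submodule.exists_le_ker_of_notMem this
  refine ⟨(f x)⁻¹ • f, by simp [hf], fun M hM => ?_⟩
  have : f (M x) = 0 := hle ⟨⟨M, hM⟩, rfl⟩
  simp [this]

theorem finrank_range_evalAt_lt [FiniteDimensional K E] {V : Submodule K (End K E)}
    (hV : TrivialSpectrum V) {z : E} (hz : z ≠ 0) :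
    finrank K (LinearMap.range (evalAt V z)) < finrank K E := by
  apply Submodule.finrank_lt
  intro h
  obtain ⟨M, hM⟩ := (h ▸ Submodule.mem_top : z ∈ LinearMap.range (evalAt V z))
  exact hz (hV M.1 M.2 z hM)

/-- The space of endomorphisms of `E ⧸ K z` induced by the members of `V` that vanish at `z`. -/
def quotientSpace (V : Submodule K (End K E)) (z : E) :
    Submodule K (End K (E ⧸ Submodule.span K {z})) where
  carrier := {N | ∃ M ∈ V, M z = 0 ∧ ∀ x, N (Submodule.Quotient.mk x) = Submodule.Quotient.mk (M x)}
  add_mem' := by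
    rintro _ _ ⟨M, hM, hMz, h⟩ ⟨M', hM', hMz', h'⟩
    exact ⟨M + M', V.add_mem hM hM', by simp [hMz, hMz'], fun x => by simp [h, h']⟩
  zero_mem' := ⟨0, V.zero_mem, by simp, by simp⟩
  smul_mem' := by
    rintro c _ ⟨M, hM, hMz, h⟩
    exact ⟨c • M, V.smul_mem c hM, by simp [hMz], fun x => by simp [h]⟩

theorem TrivialSpectrum.quotientSpace {V : Submodule K (End K E)} (hV : TrivialSpectrum V)
    (z : E) : TrivialSpectrum (quotientSpace V z) := by
  rintro N ⟨M, hM, hMz, h⟩ x hx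
  induction x using Submodule.Quotient.induction_on with | _ x
  rw [h, Submodule.Quotient.eq, Submodule.mem_span_singleton] at hx
  obtain ⟨a, ha⟩ := hx
  rw [Submodule.Quotient.mk_eq_zero]
  have hx : M (x + a • z) = x + a • z := by
    rw [map_add, map_smul, hMz, ha, smul_zero]; abel
  have := hV M hM _ hx
  rw [eq_neg_of_add_eq_zero_left this]
  exact Submodule.neg_mem _ (Submodule.smul_mem _ _ (Submodule.mem_span_singleton_self z))

theorem finrank_ker_evalAt_le [FiniteDimensional K E] {V : Submodule K (End K E)} {z : E}
    (hz : ¬ IsBad V z) (hz0 : z ≠ 0) :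
    finrank K (LinearMap.ker (evalAt V z)) ≤ finrank K (quotientSpace V z) := by
  have hc : ∀ M : LinearMap.ker (evalAt V z),
      Submodule.span K {z} ≤ (Submodule.span K {z}).comap M.1.1 := by
    intro M
    rw [Submodule.span_singleton_le_iff_mem, Submodule.mem_comap]
    have : M.1.1 z = 0 := M.2
    rw [this]
    exact zero_mem _
  let F : LinearMap.ker (evalAt V z) →ₗ[K] quotientSpace V z :=
    { toFun := fun M => ⟨Submodule.mapQ _ _ M.1.1 (hc M), M.1.1, M.1.2, M.2, fun x => rfl⟩
      map_add' := fun M N => Subtype.ext (by ext; rfl)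
      map_smul' := fun M N => Subtype.ext (by ext; rfl) }
  refine LinearMap.finrank_le_finrank_of_injective (f := F) ?_
  suffices h : ∀ M, F M = 0 → M = 0 by
    intro M N hMN
    refine sub_eq_zero.1 (h _ ?_)
    rw [sub_eq_add_neg, ← neg_one_smul K N, F.map_add, F.map_smul, hMN]
    exact Subtype.ext (by simp)
  intro M hM
  have h1 : ∀ x, ∃ a : K, a • z = M.1.1 x := by
    intro x
    have : Submodule.mapQ _ _ M.1.1 (hc M) (Submodule.Quotient.mk x) = 0 := by
      rw [show Submodule.mapQ _ _ M.1.1 (hc M) = 0 from congrArg Subtype.val hM]; rfl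
    rw [Submodule.mapQ_apply, Submodule.Quotient.mk_eq_zero, Submodule.mem_span_singleton] at this
    exact this
  obtain ⟨g, hg⟩ : ∃ g : Dual K E, g z = 1 := by
    obtain ⟨g, hg, _⟩ := Submodule.exists_le_ker_of_notMem (p := (⊥ : Submodule K E)) (v := z)
      (by simpa using hz0)
    exact ⟨(g z)⁻¹ • g, by simp [hg]⟩
  have h2 : M.1.1 = (g.comp M.1.1).smulRight z := by
    ext x
    obtain ⟨a, ha⟩ := h1 x
    simp [← ha, hg]
  by_contra hne
  refine hz ⟨g.comp M.1.1, fun h => hne ?_, h2 ▸ M.1.2⟩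
  apply Subtype.ext
  apply Subtype.ext
  rw [h2, h]
  ext; simp

theorem finrank_quotient_span [FiniteDimensional K E] {z : E} (hz : z ≠ 0) {n : ℕ}
    (hn : finrank K E = n + 1) : finrank K (E ⧸ Submodule.span K {z}) = n := by
  have := Submodule.finrank_quotient_add_finrank (Submodule.span K {z})
  rw [finrank_span_singleton hz, hn] at this
  omega

/-- A space of endomorphisms with trivial spectrum has dimension at most `n(n-1)/2`. -/
theorem TrivialSpectrum.finrank_le (n : ℕ) : ∀ {E : Type*} [AddCommGroup E] [Module K E]
    [FiniteDimensional K E], finrank K E = n → ∀ {V : Submodule K (End K E)},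
    TrivialSpectrum V → finrank K V ≤ n.choose 2 := by
  induction n with
  | zero =>
    intro E _ _ _ hn V hV
    have : Subsingleton E := finrank_zero_iff.1 hn
    have := finrank_zero_of_subsingleton (R := K) (M := V)
    simp [this]
  | succ n ih =>
    intro E _ _ _ hn V hV
    have : Nontrivial E := nontrivial_of_finrank_pos (R := K) (by omega)
    obtain ⟨z, hz⟩ := exists_not_isBad hV
    have hz0 : z ≠ 0 := by rintro rfl; exact hz (isBad_zero V)
    have h1 := LinearMap.finrank_range_add_finrank_ker (evalAt V z)
    have h2 := finrank_range_evalAt_lt hV hz0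
    have h3 := finrank_ker_evalAt_le hz hz0
    have h4 := ih (finrank_quotient_span hz0 hn) (hV.quotientSpace z)
    have h5 : (n + 1).choose 2 = n + n.choose 2 := by
      rw [Nat.choose_succ_succ' n 1, Nat.choose_one_right]
    omega

/-- A space of endomorphisms with trivial spectrum of the maximal possible dimension. -/
structure IsMaxTrivialSpectrum (V : Submodule K (End K E)) : Prop where
  trivialSpectrum : TrivialSpectrum V
  finrank_eq : finrank K V = (finrank K E).choose 2

theorem IsMaxTrivialSpectrum.exists_dual [FiniteDimensional K E] [Nontrivial E]
    {V : Submodule K (End K E)} (hV : IsMaxTrivialSpectrum V) {z : E} (hz : ¬ IsBad V z) :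
    IsMaxTrivialSpectrum (quotientSpace V z) ∧ ∃ κ : Dual K E, κ z = 1 ∧ (∀ M ∈ V, κ (M z) = 0) ∧
      ∀ f : Dual K E, (∀ M ∈ V, f (M z) = 0) → f = f z • κ := by
  have hz0 : z ≠ 0 := by rintro rfl; exact hz (isBad_zero V)
  obtain ⟨n, hn⟩ : ∃ n, finrank K E = n + 1 :=
    Nat.exists_eq_succ_of_ne_zero (finrank_pos (R := K) (M := E)).ne'
  have hV' := hV.finrank_eq
  have h1 := LinearMap.finrank_range_add_finrank_ker (evalAt V z)
  have h2 := finrank_range_evalAt_lt hV.1 hz0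
  have h3 := finrank_ker_evalAt_le hz hz0
  have hq := finrank_quotient_span hz0 hn
  have h4 := (hV.1.quotientSpace z).finrank_le n hq
  have h5 : (n + 1).choose 2 = n + n.choose 2 := by
    rw [Nat.choose_succ_succ' n 1, Nat.choose_one_right]
  rw [hn] at hV'
  refine ⟨⟨hV.1.quotientSpace z, by rw [hq]; omega⟩, ?_⟩
  obtain ⟨κ, hκ1, hκ⟩ := exists_dual_of_ne_zero hV.1 hz0
  refine ⟨κ, hκ1, hκ, fun f hf => ?_⟩
  have hle : LinearMap.range (evalAt V z) ≤ LinearMap.ker κ := by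
    rintro _ ⟨M, rfl⟩
    exact hκ M.1 M.2
  have hker : finrank K (LinearMap.ker κ) < finrank K E := by
    apply Submodule.finrank_lt
    intro h
    have : κ z = 0 := (h ▸ Submodule.mem_top : z ∈ LinearMap.ker κ)
    simp [hκ1] at this
  have heq := Submodule.eq_of_le_of_finrank_le hle (by omega)
  ext x
  have hx : x - κ x • z ∈ LinearMap.range (evalAt V z) := by
    rw [heq, LinearMap.mem_ker]
    simp [hκ1]
  obtain ⟨M, hM⟩ := hx
  have := hf M.1 M.2
  rw [← evalAt_apply, hM, map_sub, map_smul, sub_eq_zero] at this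
  rw [this]
  simp [mul_comm]

end TrivialSpectrum

section AdaptedForm

variable {K : Type*} [Field K] {E : Type*} [AddCommGroup E] [Module K E]

/-- A non-zero bilinear form `b` for which all members of `V` are alternating, which is
non-isotropic modulo its radical, and for which `V x` is the right orthogonal of `x` whenever `x` is
outside the radical. -/
structure IsAdaptedForm (V : Submodule K (End K E)) (b : E →ₗ[K] Dual K E) : Prop where
  ne_zero : b ≠ 0
  alternating : ∀ M ∈ V, ∀ x, b x (M x) = 0
  anisotropic : ∀ x, b x x = 0 → b x = 0
  radical : ∀ x, b x = 0 → ∀ y, b y x = 0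
  orthogonal : ∀ x, b x ≠ 0 → ∀ f : Dual K E, (∀ M ∈ V, f (M x) = 0) → ∃ c : K, f = c • b x

theorem polar_eq_zero {φ : E →ₗ[K] Dual K E} {M : End K E} (h : ∀ x, φ x (M x) = 0) (x y : E) :
    φ x (M y) + φ y (M x) = 0 := by
  have := h (x + y)
  simpa [h x, h y] using this

theorem right_radical_of_isBad {V : Submodule K (End K E)} {b : E →ₗ[K] Dual K E}
    (hb : ∀ M ∈ V, ∀ x, b x (M x) = 0) {x : E} (hx : IsBad V x) (y : E) : b y x = 0 := by
  obtain ⟨f, hf, hfV⟩ := hx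
  have h : ∀ y, f y * b y x = 0 := fun y => by simpa using hb _ hfV y
  obtain ⟨y₀, hy₀⟩ : ∃ y₀, f y₀ ≠ 0 := by
    by_contra! hcon
    exact hf (LinearMap.ext hcon)
  have h0 : ∀ y, f y ≠ 0 → b y x = 0 := fun y hy => (mul_eq_zero.1 (h y)).resolve_left hy
  by_cases hy : f y = 0
  · have := h0 (y + y₀) (by simpa [hy] using hy₀)
    simpa [h0 y₀ hy₀] using this
  · exact h0 y hy

theorem finrank_ker_flip [FiniteDimensional K E] (b : E →ₗ[K] Dual K E) :
    finrank K (LinearMap.ker b.flip) = finrank K (LinearMap.ker b) := by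
  have h1 := LinearMap.finrank_range_add_finrank_ker b
  have h2 := LinearMap.finrank_range_add_finrank_ker b.flip
  have h3 := LinearMap.finrank_range_dualMap_eq_finrank_range b
  have h4 : b.flip = b.dualMap ∘ₗ (evalEquiv K E).toLinearMap := by
    ext x y; simp
  have h5 : LinearMap.range b.flip = LinearMap.range b.dualMap := by
    rw [h4, LinearMap.range_comp_of_range_eq_top _ (LinearEquiv.range _)]
  have h6 : finrank K (LinearMap.range b.flip) = finrank K (LinearMap.range b) := by
    rw [h5]; exact h3
  omega

variable [FiniteDimensional K E] [Nontrivial E] {V : Submodule K (End K E)}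

theorem IsMaxTrivialSpectrum.isAdaptedForm (hV : IsMaxTrivialSpectrum V) {b : E →ₗ[K] Dual K E}
    (hb0 : b ≠ 0) (hb : ∀ M ∈ V, ∀ x, b x (M x) = 0) (hrad : ∀ x, b x = 0 → ∀ y, b y x = 0) :
    IsAdaptedForm V b := by
  have hle : LinearMap.ker b ≤ LinearMap.ker b.flip := by
    intro x hx
    ext y
    exact hrad x hx y
  have heq := Submodule.eq_of_le_of_finrank_le hle (finrank_ker_flip b).le
  have hgood : ∀ x, b x ≠ 0 → ¬ IsBad V x := by
    intro x hx hbad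
    have : x ∈ LinearMap.ker b.flip := by
      ext y
      exact right_radical_of_isBad hb hbad y
    rw [← heq] at this
    exact hx this
  have hval : ∀ x, b x ≠ 0 → b x x ≠ 0 := by
    intro x hx h
    obtain ⟨-, κ, -, -, hκ⟩ := hV.exists_dual (hgood x hx)
    apply hx
    rw [hκ (b x) (fun M hM => hb M hM x), h, zero_smul]
  refine ⟨hb0, hb, fun x hx => by_contra fun h => hval x h hx, hrad, fun x hx f hf => ?_⟩
  obtain ⟨-, κ, -, -, hκ⟩ := hV.exists_dual (hgood x hx)
  refine ⟨f x / b x x, ?_⟩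
  have h1 := hκ f hf
  have h2 := hκ (b x) (fun M hM => hb M hM x)
  have h3 := hval x hx
  rw [h1, h2, smul_smul]
  simp only [LinearMap.smul_apply, smul_eq_mul]
  have h4 : κ x ≠ 0 := fun h => h3 (by rw [h2]; simp [h])
  have : f x * κ x / (b x x * κ x) * b x x = f x := by field_simp
  rw [this]

/-- A form for which all members of `V` are alternating may be modified to become adapted. -/
theorem IsMaxTrivialSpectrum.exists_isAdaptedForm_of_form (hV : IsMaxTrivialSpectrum V)
    {b : E →ₗ[K] Dual K E} (hb0 : b ≠ 0) (hb : ∀ M ∈ V, ∀ x, b x (M x) = 0) :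
    ∃ b' : E →ₗ[K] Dual K E, IsAdaptedForm V b' := by
  by_cases hL : ∀ x, b x = 0 → IsBad V x
  · exact ⟨b, hV.isAdaptedForm hb0 hb fun x hx y => right_radical_of_isBad hb (hL x hx) y⟩
  push Not at hL
  obtain ⟨x, hx, hgood⟩ := hL
  obtain ⟨-, κ, hκx, -, hκ⟩ := hV.exists_dual hgood
  have hy : ∀ y, b y = b y x • κ := fun y => hκ _ fun M hM => by
    have := polar_eq_zero (hb M hM) y x
    simpa [hx] using this
  obtain ⟨y₀, hy₀⟩ : ∃ y₀, b y₀ x ≠ 0 := by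
    by_contra! hcon
    exact hb0 (LinearMap.ext fun y => by rw [hy y, hcon y]; simp)
  have h1 : ∀ M ∈ V, ∀ y, b y x ≠ 0 → κ (M y) = 0 := by
    intro M hM y hne
    have := hb M hM y
    rw [hy y] at this
    simpa [hne] using this
  have h2 : ∀ M ∈ V, ∀ y, κ (M y) = 0 := by
    intro M hM y
    by_cases hne : b y x = 0
    · have h3 := h1 M hM (y + y₀) (by simpa [hne] using hy₀)
      simpa [h1 M hM y₀ hy₀] using h3
    · exact h1 M hM y hne
  refine ⟨κ.smulRight κ, hV.isAdaptedForm (fun h => ?_) (fun M hM y => by simp [h2 M hM])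
    (fun y h z => ?_)⟩
  · have := LinearMap.congr_fun (LinearMap.congr_fun h x) x
    simp [hκx] at this
  · have := LinearMap.congr_fun h x
    simp [hκx] at this
    simp [this]

end AdaptedForm

section Lifting

variable {K : Type*} [Field K] {E : Type*} [AddCommGroup E] [Module K E]

/-- The form `φ`, with `z` in its radical, comes from a form on `E ⧸ K z` adapted to the space
induced by the members of `V` that vanish at `z`, and `V z` is the kernel of `κ`. -/
structure IsLift (V : Submodule K (End K E)) (z : E) (κ : Dual K E) (φ : E →ₗ[K] Dual K E) :
    Prop where
  trivialSpectrum : TrivialSpectrum V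
  apply_self : κ z = 1
  apply_map : ∀ M ∈ V, κ (M z) = 0
  unique : ∀ f : Dual K E, (∀ M ∈ V, f (M z) = 0) → f = f z • κ
  ne_zero : φ ≠ 0
  left_eq_zero : φ z = 0
  right_eq_zero : ∀ x, φ x z = 0
  alternating : ∀ M ∈ V, M z = 0 → ∀ x, φ x (M x) = 0
  orthogonal : ∀ x, φ x ≠ 0 → ∀ f : Dual K E, f z = 0 → (∀ M ∈ V, M z = 0 → f (M x) = 0) →
    ∃ c : K, f = c • φ x

namespace IsLift

variable {V : Submodule K (End K E)} {z : E} {κ : Dual K E} {φ : E →ₗ[K] Dual K E}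

theorem eq_zero (h : IsLift V z κ φ) {f : Dual K E} (hz : f z = 0) (hf : ∀ M ∈ V, f (M z) = 0) :
    f = 0 := by
  rw [h.unique f hf, hz, zero_smul]

theorem exists_factor (h : IsLift V z κ φ) (ℓ : End K E →ₗ[K] K)
    (hℓ : ∀ M ∈ V, M z = 0 → ℓ M = 0) : ∃ g : Dual K E, g z = 0 ∧ ∀ M ∈ V, ℓ M + g (M z) = 0 := by
  have : ℓ ∘ₗ V.subtype ∈ LinearMap.range (evalAt V z).dualMap := by
    rw [LinearMap.range_dualMap_eq_dualAnnihilator_ker, Submodule.mem_dualAnnihilator]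
    intro M hM
    exact hℓ M.1 M.2 hM
  obtain ⟨g, hg⟩ := this
  refine ⟨g z • κ - g, by simp [h.apply_self], fun M hM => ?_⟩
  have h1 : g (M z) = ℓ M := LinearMap.congr_fun hg ⟨M, hM⟩
  simp [h.apply_map M hM, h1]

theorem exists_dual (h : IsLift V z κ φ) {x : E} (hx : φ x ≠ 0) (t : K) :
    ∃ δ : Dual K E, δ (x + t • z) ≠ 0 ∧ ∀ M ∈ V, δ (M x) + t * δ (M z) = 0 := by
  have hne : x + t • z ≠ 0 := by
    intro h0
    apply hx
    have := congrArg φ h0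
    simpa [h.left_eq_zero] using this
  obtain ⟨δ, h1, h2⟩ := exists_dual_of_ne_zero h.trivialSpectrum hne
  exact ⟨δ, by simp [h1], fun M hM => by simpa using h2 M hM⟩

theorem orthogonal_of_dual (h : IsLift V z κ φ) {x : E} (hx : φ x ≠ 0) {t : K} {δ : Dual K E}
    (hδz : δ z = 0) (hδ : ∀ M ∈ V, δ (M x) + t * δ (M z) = 0) : ∃ c : K, δ = c • φ x := by
  refine h.orthogonal x hx δ hδz fun M hM hMz => ?_
  simpa [hMz] using hδ M hM

theorem exists_eq_smul (h : IsLift V z κ φ) {τ : K} (hτ0 : τ ≠ 0) (hτ1 : τ ≠ 1) (x : E)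
    {ψ : Dual K E} (hψz : ψ z = 0) (hψ : ∀ M ∈ V, φ x (M x) + ψ (M z) = 0) :
    ∃ c : K, ψ = c • φ x := by
  by_cases hx : φ x = 0
  · exact ⟨0, by rw [zero_smul]; exact h.eq_zero hψz (by simpa [hx] using hψ)⟩
  by_cases hcase : ∃ (t : K) (δ : Dual K E), δ z = 0 ∧ δ ≠ 0 ∧ ∀ M ∈ V, δ (M x) + t * δ (M z) = 0
  · obtain ⟨t, δ, hδz, hδ0, hδ⟩ := hcase
    obtain ⟨c, rfl⟩ := h.orthogonal_of_dual hx hδz hδ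
    have hc : c ≠ 0 := by rintro rfl; simp at hδ0
    refine ⟨t, sub_eq_zero.1 (h.eq_zero (by simp [hψz, h.right_eq_zero]) fun M hM => ?_)⟩
    have h1 := hδ M hM
    have h2 := hψ M hM
    simp only [LinearMap.smul_apply, smul_eq_mul, LinearMap.sub_apply] at h1 ⊢
    refine mul_left_cancel₀ hc ?_
    linear_combination c * h2 - h1
  push Not at hcase
  have hδ : ∀ t : K, ∃ δ : Dual K E, δ z = 1 ∧ δ (x + t • z) ≠ 0 ∧
      ∀ M ∈ V, δ (M x) + t * δ (M z) = 0 := by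
    intro t
    obtain ⟨δ, h1, h2⟩ := h.exists_dual hx t
    have hz : δ z ≠ 0 := by
      intro hz
      obtain ⟨M, hM, h3⟩ := hcase t δ hz (by rintro rfl; simp at h1)
      exact h3 (h2 M hM)
    refine ⟨(δ z)⁻¹ • δ, by simp [hz], by simpa [hz] using h1, fun M hM => ?_⟩
    have := h2 M hM
    simp only [LinearMap.smul_apply, smul_eq_mul]
    linear_combination (δ z)⁻¹ * this
  choose δ hδz hδne hδ using hδ
  have ha : ∀ t, ∃ a : K, δ t - δ 0 = a • φ x := fun t => by
    refine h.orthogonal x hx _ (by simp [hδz]) fun M hM hMz => ?_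
    have h1 := hδ t M hM
    have h2 := hδ 0 M hM
    rw [hMz] at h1 h2
    simp at h1 h2
    simp [h1, h2]
  choose a ha using ha
  have hE : ∀ t, a t • ψ - t • δ 0 - (t * a t) • φ x = -t • κ := by
    intro t
    rw [h.unique (a t • ψ - t • δ 0 - (t * a t) • φ x)]
    · simp [hψz, hδz, h.right_eq_zero]
    · intro M hM
      have h1 := hδ t M hM
      have h2 := hδ 0 M hM
      have h3 := hψ M hM
      rw [sub_eq_iff_eq_add.1 (ha t)] at h1
      simp only [LinearMap.smul_apply, smul_eq_mul, LinearMap.sub_apply, LinearMap.add_apply] at *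
      linear_combination a t * h3 - h1 + h2
  by_contra hcon
  have hψφ : ∀ p q : K, p • ψ = q • φ x → p = 0 := by
    intro p q hpq
    by_contra hp
    exact hcon ⟨p⁻¹ * q, by rw [mul_smul, ← hpq, smul_smul, inv_mul_cancel₀ hp, one_smul]⟩
  have hrel : ∀ t, (a t - t * a 1) • ψ = (t * (a t - a 1)) • φ x := by
    intro t
    have h1 := hE t
    have h2 := hE 1
    ext w
    have h3 := LinearMap.congr_fun h1 w
    have h4 := LinearMap.congr_fun h2 w
    simp only [LinearMap.sub_apply, LinearMap.smul_apply, smul_eq_mul] at h3 h4 ⊢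
    linear_combination h3 - t * h4
  have h1 : ∀ t, a t = t * a 1 := fun t => sub_eq_zero.1 (hψφ _ _ (hrel t))
  have h2 : ∀ t, t * (a t - a 1) = 0 := by
    intro t
    have := hrel t
    rw [h1 t, sub_self, zero_smul] at this
    have := (smul_eq_zero.1 this.symm).resolve_right hx
    rw [h1 t]; exact this
  have h3 : a 1 = 0 := by
    have := h2 τ
    rw [h1 τ] at this
    have h4 : τ * (τ - 1) * a 1 = 0 := by linear_combination this
    exact (mul_eq_zero.1 h4).resolve_left (mul_ne_zero hτ0 (sub_ne_zero.2 hτ1))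
  have h4 : δ 0 = κ := by
    ext w
    have h5 := LinearMap.congr_fun (hE 1) w
    simp only [LinearMap.sub_apply, LinearMap.smul_apply, smul_eq_mul, h3] at h5
    linear_combination -h5
  have h5 : δ (-κ x) = κ := by
    have := ha (-κ x)
    rw [h1, h3, mul_zero, zero_smul, sub_eq_zero] at this
    rw [this, h4]
  apply hδne (-κ x)
  rw [h5]
  simp [h.apply_self]

/-- Two non-zero scalars being available, the quadratic correction is linear times `φ`. -/
theorem exists_linear (h : IsLift V z κ φ) {τ : K} (hτ0 : τ ≠ 0) (hτ1 : τ ≠ 1) :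
    ∃ l : E →ₗ[K] K, l z = -1 ∧ ∀ x, ∀ M ∈ V, φ x (M x) + l x * φ x (M z) = 0 := by
  have hψ : ∀ x, ∃ ψ : Dual K E, ψ z = 0 ∧ ∀ M ∈ V, φ x (M x) + ψ (M z) = 0 := fun x =>
    h.exists_factor (φ x ∘ₗ LinearMap.applyₗ x) fun M hM hMz => h.alternating M hM hMz x
  choose ψ hψz hψ using hψ
  have hm : ∀ x, ∃ m : K, ψ x = m • φ x := fun x => h.exists_eq_smul hτ0 hτ1 x (hψz x) (hψ x)
  choose m hm using hm
  obtain ⟨y, hy⟩ : ∃ y, φ y ≠ 0 := by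
    by_contra! hcon
    exact h.ne_zero (LinearMap.ext hcon)
  obtain ⟨v, hv⟩ : ∃ v, φ y v = 1 := by
    obtain ⟨v, hv⟩ : ∃ v, φ y v ≠ 0 := by
      by_contra! hcon
      exact hy (LinearMap.ext hcon)
    exact ⟨(φ y v)⁻¹ • v, by simp [hv]⟩
  have hΨ : ∀ x, ∃ g : Dual K E, g z = 0 ∧ ∀ M ∈ V, φ y (M x) + φ x (M y) + g (M z) = 0 := fun x =>
    h.exists_factor (φ y ∘ₗ LinearMap.applyₗ x + φ x ∘ₗ LinearMap.applyₗ y) fun M hM hMz => by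
      exact polar_eq_zero (h.alternating M hM hMz) y x
  choose Ψ hΨz hΨ using hΨ
  have hadd : ∀ a b, Ψ (a + b) = Ψ a + Ψ b := fun a b => by
    refine sub_eq_zero.1 (h.eq_zero (by simp [hΨz]) fun M hM => ?_)
    have h1 := hΨ a M hM
    have h2 := hΨ b M hM
    have h3 := hΨ (a + b) M hM
    simp only [map_add, LinearMap.sub_apply, LinearMap.add_apply] at *
    linear_combination h3 - h1 - h2
  have hsmul : ∀ (c : K) a, Ψ (c • a) = c • Ψ a := fun c a => by
    refine sub_eq_zero.1 (h.eq_zero (by simp [hΨz]) fun M hM => ?_)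
    have h1 := hΨ a M hM
    have h3 := hΨ (c • a) M hM
    simp only [map_smul, LinearMap.sub_apply, LinearMap.smul_apply, smul_eq_mul] at *
    linear_combination h3 - c * h1
  have hquad : ∀ (c : K) w, ψ (c • y + w) = (c ^ 2) • ψ y + ψ w + c • Ψ w := fun c w => by
    refine sub_eq_zero.1 (h.eq_zero (by simp [hΨz, hψz]) fun M hM => ?_)
    have h1 := hψ y M hM
    have h2 := hψ w M hM
    have h3 := hψ (c • y + w) M hM
    have h4 := hΨ w M hM
    simp only [map_add, map_smul, LinearMap.sub_apply, LinearMap.add_apply, LinearMap.smul_apply,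
      smul_eq_mul] at *
    linear_combination h3 - c ^ 2 * h1 - h2 - c * h4
  have hΨy : Ψ y = 2 • ψ y := by
    refine sub_eq_zero.1 (h.eq_zero (by simp [hΨz, hψz]) fun M hM => ?_)
    have h1 := hψ y M hM
    have h2 := hΨ y M hM
    simp only [LinearMap.sub_apply, LinearMap.smul_apply, nsmul_eq_mul] at *
    push_cast
    linear_combination h2 - 2 * h1
  let l : E →ₗ[K] K :=
    { toFun := fun x => Ψ x v - m y * φ x v
      map_add' := fun a b => by simp [hadd]; ring
      map_smul' := fun c a => by simp [hsmul]; ring }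
  have hl : ∀ x, ψ x = l x • φ x := by
    intro x
    change ψ x = (Ψ x v - m y * φ x v) • φ x
    by_cases hdep : ∃ c : K, φ x = c • φ y
    · obtain ⟨c, hc⟩ := hdep
      obtain ⟨w, rfl⟩ : ∃ w, x = c • y + w := ⟨x - c • y, by abel⟩
      have hw : φ w = 0 := by simpa using hc
      have hψw : ψ w = 0 := by rw [hm w, hw, smul_zero]
      have hΨw : Ψ w = (m ((1 : K) • y + w) - m y) • φ y := by
        have h1 := hquad 1 w
        rw [hm (1 • y + w), hψw, hm y, map_add, hw, map_smul] at h1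
        ext u
        have h2 := LinearMap.congr_fun h1 u
        simp only [LinearMap.add_apply, LinearMap.smul_apply, LinearMap.zero_apply,
          smul_eq_mul] at h2 ⊢
        linear_combination -h2
      rw [hquad, hψw, hadd, hsmul, hΨy, hΨw, hm y, hc]
      simp only [LinearMap.add_apply, LinearMap.smul_apply, smul_eq_mul, nsmul_eq_mul, hv]
      module
    · have hind : ∀ p q : K, p • φ y = q • φ x → p = 0 ∧ q = 0 := by
        intro p q hpq
        have hq : q = 0 := by
          by_contra hq
          exact hdep ⟨q⁻¹ * p, by rw [mul_smul, hpq, smul_smul, inv_mul_cancel₀ hq, one_smul]⟩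
        subst hq
        rw [zero_smul] at hpq
        exact ⟨(smul_eq_zero.1 hpq).resolve_right hy, rfl⟩
      have h1 := hquad 1 x
      have h2 := hquad τ x
      rw [hm (1 • y + x), hm y, hm x] at h1
      rw [hm (τ • y + x), hm y, hm x] at h2
      obtain ⟨m₁, hm₁⟩ : ∃ m₁, m ((1 : K) • y + x) = m₁ := ⟨_, rfl⟩
      obtain ⟨m₂, hm₂⟩ : ∃ m₂, m (τ • y + x) = m₂ := ⟨_, rfl⟩
      rw [map_add, map_smul, hm₁] at h1
      rw [map_add, map_smul, hm₂] at h2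
      have h3 : (m₂ * τ - τ ^ 2 * m y - τ * (m₁ - m y)) • φ y
          = (m x + τ * (m₁ - m x) - m₂) • φ x := by
        ext u
        have h4 := LinearMap.congr_fun h1 u
        have h5 := LinearMap.congr_fun h2 u
        simp only [LinearMap.add_apply, LinearMap.smul_apply, smul_eq_mul] at h4 h5 ⊢
        linear_combination h5 - τ * h4
      obtain ⟨h4, h5⟩ := hind _ _ h3
      have h6 : m₁ = m y + m x := by
        have : τ * (τ - 1) * (m₁ - (m y + m x)) = 0 := by
          linear_combination τ * h5 + h4
        have := (mul_eq_zero.1 this).resolve_left (mul_ne_zero hτ0 (sub_ne_zero.2 hτ1))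
        linear_combination this
      have h7 : Ψ x = m x • φ y + m y • φ x := by
        ext u
        have h8 := LinearMap.congr_fun h1 u
        simp only [LinearMap.add_apply, LinearMap.smul_apply, smul_eq_mul, h6] at h8 ⊢
        linear_combination -h8
      rw [h7, hm x]
      simp [hv]
  have hfin : ∀ x, ∀ M ∈ V, φ x (M x) + l x * φ x (M z) = 0 := fun x M hM => by
    have := hψ x M hM
    rw [hl x] at this
    simpa using this
  refine ⟨l, ?_, hfin⟩
  by_contra hne
  have hne' : 1 + l z ≠ 0 := fun h0 => hne (by linear_combination h0)
  refine hy (h.eq_zero (h.right_eq_zero y) fun M hM => mul_left_cancel₀ hne' ?_)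
  have h1 := hfin y M hM
  have h2 := hfin (y + z) M hM
  simp only [map_add, h.left_eq_zero, add_zero] at h2
  linear_combination h2 - h1

theorem exists_mixed (h : IsLift V z κ φ) {τ : K} (hτ0 : τ ≠ 0) (hτ1 : τ ≠ 1) {x : E}
    (hx : φ x ≠ 0) (hx' : ∀ M ∈ V, φ x (M x) = 0) :
    ∃ c : K, ∀ M ∈ V, κ (M x) + c * φ x (M z) = 0 := by
  have hδ : ∀ t : K, t ≠ 0 → ∃ δ : Dual K E, δ z = 1 ∧ ∀ M ∈ V, δ (M x) + t * δ (M z) = 0 := by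
    intro t ht
    obtain ⟨δ, h1, h2⟩ := h.exists_dual hx t
    have hz : δ z ≠ 0 := by
      intro hz
      obtain ⟨c, rfl⟩ := h.orthogonal_of_dual hx hz h2
      have hc : c ≠ 0 := by rintro rfl; simp at h1
      refine hx (h.eq_zero (h.right_eq_zero x) fun M hM => ?_)
      have := h2 M hM
      simp only [LinearMap.smul_apply, smul_eq_mul, hx' M hM] at this
      refine mul_left_cancel₀ (mul_ne_zero ht hc) ?_
      linear_combination this
    refine ⟨(δ z)⁻¹ • δ, by simp [hz], fun M hM => ?_⟩
    have := h2 M hM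
    simp only [LinearMap.smul_apply, smul_eq_mul]
    linear_combination (δ z)⁻¹ * this
  obtain ⟨δ, hδz, hδ1⟩ := hδ 1 one_ne_zero
  obtain ⟨ε, hεz, hε⟩ := hδ τ hτ0
  obtain ⟨a, ha⟩ := h.orthogonal x hx (ε - δ) (by simp [hδz, hεz]) fun M hM hMz => by
    have h1 := hδ1 M hM
    have h2 := hε M hM
    rw [hMz] at h1 h2
    simp at h1 h2
    simp [h1, h2]
  have hE : (1 - τ) • δ - (τ * a) • φ x = (1 - τ) • κ := by
    rw [h.unique ((1 - τ) • δ - (τ * a) • φ x)]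
    · simp [hδz, h.right_eq_zero]
    · intro M hM
      have h1 := hδ1 M hM
      have h2 := hε M hM
      have h3 := hx' M hM
      rw [sub_eq_iff_eq_add.1 ha] at h2
      simp only [LinearMap.smul_apply, smul_eq_mul, LinearMap.sub_apply, LinearMap.add_apply] at *
      linear_combination h1 - h2 + a * h3
  have hτ : 1 - τ ≠ 0 := sub_ne_zero.2 (Ne.symm hτ1)
  refine ⟨τ * a / (1 - τ), fun M hM => ?_⟩
  have h1 := hδ1 M hM
  have h3 := hx' M hM
  have h4 := h.apply_map M hM
  have h5 : ∀ w, (1 - τ) * δ w - τ * a * φ x w = (1 - τ) * κ w := fun w =>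
    LinearMap.congr_fun hE w
  have h6 := h5 (M x)
  have h7 := h5 (M z)
  field_simp
  rw [h3] at h6
  rw [h4] at h7
  linear_combination (1 - τ) * h1 - h6 - h7

theorem exists_form (h : IsLift V z κ φ) {τ : K} (hτ0 : τ ≠ 0) (hτ1 : τ ≠ 1) :
    ∃ b : E →ₗ[K] Dual K E, b ≠ 0 ∧ ∀ M ∈ V, ∀ x, b x (M x) = 0 := by
  obtain ⟨l, hlz, hl⟩ := h.exists_linear hτ0 hτ1
  have hH : ∀ x, l x = 0 → ∀ M ∈ V, φ x (M x) = 0 := fun x hx M hM => by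
    simpa [hx] using hl x M hM
  have hproj : ∀ w, l (w + l w • z) = 0 := fun w => by simp [hlz]
  have hφproj : ∀ w, φ (w + l w • z) = φ w := fun w => by simp [h.left_eq_zero]
  -- it suffices to find a suitable linear map on the kernel of `l`
  suffices hχ : ∃ χ : E →ₗ[K] Dual K E, χ z = 0 ∧
      (∀ x, l x = 0 → ∀ M ∈ V, χ x (M x) = 0) ∧
      (∀ x, l x = 0 → ∀ M ∈ V, κ (M x) + χ x (M z) = 0) ∧ ∀ x, χ x z = 0 by
    obtain ⟨χ, hχz, h1, h2, -⟩ := hχ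
    refine ⟨χ - l.smulRight κ, fun h0 => ?_, fun M hM w => ?_⟩
    · have := LinearMap.congr_fun (LinearMap.congr_fun h0 z) z
      simp [hχz, hlz, h.apply_self] at this
    · have h3 := h1 _ (hproj w) M hM
      have h4 := h2 _ (hproj w) M hM
      have h5 := h.apply_map M hM
      simp only [map_add, map_smul, hχz, LinearMap.sub_apply, smul_zero, add_zero, smul_eq_mul,
        LinearMap.smulRight_apply, LinearMap.smul_apply] at *
      linear_combination h3 - l w * h4 + l w * l w * h5
  obtain ⟨y, hyl, hy⟩ : ∃ y, l y = 0 ∧ φ y ≠ 0 := by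
    by_contra! hcon
    refine h.ne_zero (LinearMap.ext fun w => ?_)
    rw [← hφproj, hcon _ (hproj w)]; rfl
  have hmix : ∀ x, l x = 0 → φ x ≠ 0 → ∃ c : K, ∀ M ∈ V, κ (M x) + c * φ x (M z) = 0 :=
    fun x hx hne => h.exists_mixed hτ0 hτ1 hne (hH x hx)
  obtain ⟨θ, hθ⟩ := hmix y hyl hy
  by_cases hrank : ∃ y', l y' = 0 ∧ ∀ c : K, φ y' ≠ c • φ y
  · obtain ⟨y', hy'l, hy'⟩ := hrank
    have hind : ∀ x, l x = 0 → (∀ c : K, φ x ≠ c • φ y) →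
        ∀ M ∈ V, κ (M x) + θ * φ x (M z) = 0 := by
      intro x hx hxy
      have hx0 : φ x ≠ 0 := by simpa using hxy 0
      have hxy0 : φ (x + y) ≠ 0 := fun h0 => hxy (-1) (by
        ext u
        have h1 := LinearMap.congr_fun h0 u
        simp only [map_add, LinearMap.add_apply, LinearMap.zero_apply, LinearMap.smul_apply,
          smul_eq_mul] at h1 ⊢
        linear_combination h1)
      obtain ⟨c, hc⟩ := hmix x hx hx0
      obtain ⟨d, hd⟩ := hmix (x + y) (by simp [hx, hyl]) hxy0
      have hz : (d - c) • φ x + (d - θ) • φ y = 0 := by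
        refine h.eq_zero (by simp [h.right_eq_zero]) fun M hM => ?_
        have h1 := hc M hM
        have h2 := hd M hM
        have h3 := hθ M hM
        simp only [map_add, LinearMap.add_apply, LinearMap.smul_apply, smul_eq_mul] at *
        linear_combination h2 - h1 - h3
      have hdc : d - c = 0 := by
        by_contra hdc
        refine hxy (-((d - c)⁻¹ * (d - θ))) ?_
        ext u
        have h1 := LinearMap.congr_fun hz u
        simp only [LinearMap.add_apply, LinearMap.zero_apply, LinearMap.smul_apply,
          smul_eq_mul] at h1 ⊢
        field_simp
        linear_combination h1
      rw [hdc, zero_smul, zero_add] at hz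
      have hdθ := (smul_eq_zero.1 hz).resolve_right hy
      have : c = θ := by linear_combination hdθ - hdc
      rwa [this] at hc
    have hall : ∀ x, l x = 0 → ∀ M ∈ V, κ (M x) + θ * φ x (M z) = 0 := by
      intro x hx
      by_cases hxy : ∃ c : K, φ x = c • φ y
      · obtain ⟨c, hc⟩ := hxy
        intro M hM
        have h1 := hind y' hy'l hy' M hM
        have h2 := hind (x + y') (by simp [hx, hy'l]) (fun d hd => hy' (d - c) (by
          ext u
          have h3 := LinearMap.congr_fun hd u
          simp only [map_add, hc, LinearMap.add_apply, LinearMap.smul_apply, smul_eq_mul] at h3 ⊢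
          linear_combination h3)) M hM
        simp only [map_add, LinearMap.add_apply] at h2
        linear_combination h2 - h1
      · push Not at hxy
        exact hind x hx hxy
    exact ⟨θ • φ, by simp [h.left_eq_zero], fun x hx M hM => by simp [hH x hx M hM],
      fun x hx M hM => by simpa using hall x hx M hM, fun x => by simp [h.right_eq_zero]⟩
  · push Not at hrank
    have hfy : ∀ x, l x = 0 → ∀ M ∈ V, φ y (M x) = 0 := by
      intro x hx M hM
      obtain ⟨c, hc⟩ := hrank x hx
      have h1 := hH (x + y) (by simp [hx, hyl]) M hM
      have h2 := hH x hx M hM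
      have h3 := hH y hyl M hM
      simp only [map_add, LinearMap.add_apply, hc, LinearMap.smul_apply, smul_eq_mul] at *
      linear_combination h1 - h2 - h3 - c * h3
    have hcx : ∀ x, l x = 0 → ∃ c : K, ∀ M ∈ V, κ (M x) + c * φ y (M z) = 0 := by
      intro x hx
      by_cases hx0 : φ x = 0
      · obtain ⟨c, hc⟩ := hmix (x + y) (by simp [hx, hyl]) (by simpa [hx0] using hy)
        refine ⟨c - θ, fun M hM => ?_⟩
        have h1 := hc M hM
        have h2 := hθ M hM
        simp only [map_add, hx0, zero_add] at h1
        linear_combination h1 - h2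
      · obtain ⟨c, hc⟩ := hmix x hx hx0
        obtain ⟨d, hd⟩ := hrank x hx
        refine ⟨c * d, fun M hM => ?_⟩
        have h1 := hc M hM
        rw [hd] at h1
        simp only [LinearMap.smul_apply, smul_eq_mul] at h1
        linear_combination h1
    obtain ⟨N, hN, hNy⟩ : ∃ N ∈ V, φ y (N z) ≠ 0 := by
      by_contra! hcon
      exact hy (h.eq_zero (h.right_eq_zero y) hcon)
    let P : E →ₗ[K] E := LinearMap.id + l.smulRight z
    have hPz : P z = 0 := by simp [P, hlz]
    have hP : ∀ x, l x = 0 → P x = x := fun x hx => by simp [P, hx]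
    refine ⟨((-(φ y (N z))⁻¹) • (κ ∘ₗ N ∘ₗ P)).smulRight (φ y), by simp [hPz], fun x hx M hM => by
      simp [hfy x hx M hM], fun x hx M hM => ?_, fun x => by simp [h.right_eq_zero]⟩
    obtain ⟨c, hc⟩ := hcx x hx
    have h1 := hc M hM
    have h2 := hc N hN
    simp only [LinearMap.smulRight_apply, LinearMap.smul_apply, LinearMap.comp_apply, smul_eq_mul,
      hP x hx]
    have h3 : κ (N x) = -(c * φ y (N z)) := eq_neg_of_add_eq_zero_left h2
    rw [h3]
    field_simp
    exact h1

end IsLift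

/-- The main existence result: a maximal space with trivial spectrum has an adapted form. -/
theorem IsMaxTrivialSpectrum.exists_isAdaptedForm {K : Type*} [Field K] {τ : K} (hτ0 : τ ≠ 0)
    (hτ1 : τ ≠ 1) (n : ℕ) :
    ∀ {E : Type*} [AddCommGroup E] [Module K E] [FiniteDimensional K E],
      finrank K E = n + 1 → ∀ {V : Submodule K (End K E)}, IsMaxTrivialSpectrum V →
      ∃ b : E →ₗ[K] Dual K E, IsAdaptedForm V b := by
  induction n with
  | zero =>
    intro E _ _ _ hn V hV
    have : Nontrivial E := nontrivial_of_finrank_pos (R := K) (by omega)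
    have hV0 : V = ⊥ := by
      rw [← Submodule.finrank_eq_zero (R := K), hV.finrank_eq, hn]; rfl
    obtain ⟨f, hf⟩ := exists_ne (0 : Dual K E)
    refine hV.exists_isAdaptedForm_of_form (b := f.smulRight f) (fun h0 => hf ?_) fun M hM x => ?_
    · ext x
      have := LinearMap.congr_fun (LinearMap.congr_fun h0 x) x
      simpa using this
    · rw [hV0, Submodule.mem_bot] at hM
      simp [hM]
  | succ n ih =>
    intro E _ _ _ hn V hV
    have : Nontrivial E := nontrivial_of_finrank_pos (R := K) (by omega)
    obtain ⟨z, hz⟩ := exists_not_isBad hV.1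
    have hz0 : z ≠ 0 := by rintro rfl; exact hz (isBad_zero V)
    obtain ⟨hQ, κ, hκz, hκ, hκu⟩ := hV.exists_dual hz
    obtain ⟨b, hb⟩ := ih (finrank_quotient_span hz0 hn) hQ
    let π := (Submodule.span K {z}).mkQ
    have hπz : π z = 0 := by
      simp [π]
    have hlift : ∀ M ∈ V, M z = 0 → ∃ N ∈ quotientSpace V z, ∀ x, N (π x) = π (M x) := by
      intro M hM hMz
      have hle : Submodule.span K {z} ≤ (Submodule.span K {z}).comap M := by
        rw [Submodule.span_singleton_le_iff_mem, Submodule.mem_comap, hMz]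
        exact zero_mem _
      exact ⟨Submodule.mapQ _ _ M hle, ⟨M, hM, hMz, fun x => rfl⟩, fun x => rfl⟩
    have hπ : Function.Surjective π := Submodule.mkQ_surjective _
    have hφ : ∀ x, π.dualMap (b (π x)) = 0 → b (π x) = 0 := by
      intro x hx
      ext w
      exact LinearMap.congr_fun hx w
    have hL : IsLift V z κ (π.dualMap ∘ₗ b ∘ₗ π) :=
      { trivialSpectrum := hV.1
        apply_self := hκz
        apply_map := hκ
        unique := hκu
        ne_zero := fun h0 => hb.ne_zero <| LinearMap.ext fun w => by
          obtain ⟨x, rfl⟩ := hπ w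
          exact hφ x (LinearMap.congr_fun h0 x)
        left_eq_zero := by simp [hπz]
        right_eq_zero := fun x => by simp [hπz]
        alternating := fun M hM hMz x => by
          obtain ⟨N, hN, hNM⟩ := hlift M hM hMz
          have := hb.alternating N hN (π x)
          rw [hNM] at this
          exact this
        orthogonal := fun x hx f hfz hf => by
          have hx' : b (π x) ≠ 0 := fun h0 => hx (by simp [h0])
          have hle : Submodule.span K {z} ≤ LinearMap.ker f := by
            rw [Submodule.span_singleton_le_iff_mem]; exact hfz
          obtain ⟨c, hc⟩ := hb.orthogonal (π x) hx' ((Submodule.span K {z}).liftQ f hle) (by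
            rintro N ⟨M, hM, hMz, hNM⟩
            change (Submodule.span K {z}).liftQ f hle (N (Submodule.Quotient.mk x)) = 0
            rw [hNM]
            exact hf M hM hMz)
          refine ⟨c, LinearMap.ext fun w => ?_⟩
          exact LinearMap.congr_fun hc (π w) }
    obtain ⟨b', hb'0, hb'⟩ := hL.exists_form hτ0 hτ1
    exact hV.exists_isAdaptedForm_of_form hb'0 hb'

end Lifting

section RectEquiv

variable {K : Type*} [Field K] {ι κ μ ι' κ' : Type*} [Fintype ι] [DecidableEq ι] [Fintype κ]
  [DecidableEq κ] [Fintype μ] [DecidableEq μ] [Fintype ι'] [DecidableEq ι'] [Fintype κ']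
  [DecidableEq κ']

/-- `Y = P X Q` for invertible matrices `P`, `Q` that may have different index types. -/
def RectEquiv (X : Set (Matrix ι ι K)) (Y : Set (Matrix κ κ K)) : Prop :=
  ∃ (P : Matrix κ ι K) (P' : Matrix ι κ K) (Q : Matrix ι κ K) (Q' : Matrix κ ι K),
    P * P' = 1 ∧ P' * P = 1 ∧ Q * Q' = 1 ∧ Q' * Q = 1 ∧ Y = (fun M => P * M * Q) '' X

theorem RectEquiv.refl (X : Set (Matrix ι ι K)) : RectEquiv X X :=
  ⟨1, 1, 1, 1, by simp, by simp, by simp, by simp, by simp⟩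

theorem RectEquiv.symm {X : Set (Matrix ι ι K)} {Y : Set (Matrix κ κ K)} (h : RectEquiv X Y) :
    RectEquiv Y X := by
  obtain ⟨P, P', Q, Q', h1, h2, h3, h4, rfl⟩ := h
  refine ⟨P', P, Q', Q, h2, h1, h4, h3, ?_⟩
  rw [Set.image_image]
  have : ∀ M : Matrix ι ι K, P' * (P * M * Q) * Q' = M := fun M => by
    rw [← Matrix.mul_assoc, ← Matrix.mul_assoc, h2, Matrix.one_mul, Matrix.mul_assoc, h3,
      Matrix.mul_one]
  simp [this]

theorem RectEquiv.trans {X : Set (Matrix ι ι K)} {Y : Set (Matrix κ κ K)}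
    {Z : Set (Matrix μ μ K)} (h : RectEquiv X Y) (h' : RectEquiv Y Z) : RectEquiv X Z := by
  obtain ⟨P, P', Q, Q', h1, h2, h3, h4, rfl⟩ := h
  obtain ⟨R, R', S, S', k1, k2, k3, k4, rfl⟩ := h'
  refine ⟨R * P, P' * R', Q * S, S' * Q', ?_, ?_, ?_, ?_, ?_⟩
  · rw [Matrix.mul_assoc, ← Matrix.mul_assoc P, h1, Matrix.one_mul, k1]
  · rw [Matrix.mul_assoc, ← Matrix.mul_assoc R', k2, Matrix.one_mul, h2]
  · rw [Matrix.mul_assoc, ← Matrix.mul_assoc S, k3, Matrix.one_mul, h3]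
  · rw [Matrix.mul_assoc, ← Matrix.mul_assoc Q', h4, Matrix.one_mul, k4]
  · rw [Set.image_image]
    simp only [Matrix.mul_assoc]

theorem card_eq_of_mul_eq_one {P : Matrix κ ι K} {P' : Matrix ι κ K} (h1 : P * P' = 1)
    (h2 : P' * P = 1) : Fintype.card ι = Fintype.card κ := by
  refine le_antisymm ?_ ?_
  · have := (Matrix.rank_mul_le_right P' P).trans (Matrix.rank_le_card_height P)
    rwa [h2, Matrix.rank_one] at this
  · have := (Matrix.rank_mul_le_right P P').trans (Matrix.rank_le_card_height P')
    rwa [h1, Matrix.rank_one] at this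

theorem RectEquiv.card_eq {X : Set (Matrix ι ι K)} {Y : Set (Matrix κ κ K)}
    (h : RectEquiv X Y) : Fintype.card ι = Fintype.card κ := by
  obtain ⟨P, P', Q, Q', h1, h2, -⟩ := h
  exact card_eq_of_mul_eq_one h1 h2

theorem rectEquiv_reindex (e : ι ≃ κ) (X : Set (Matrix ι ι K)) :
    RectEquiv X (Matrix.reindex e e '' X) := by
  refine ⟨(1 : Matrix ι ι K).submatrix e.symm id, (1 : Matrix ι ι K).submatrix id e.symm,
    (1 : Matrix ι ι K).submatrix id e.symm, (1 : Matrix ι ι K).submatrix e.symm id,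
    ?_, ?_, ?_, ?_, ?_⟩
  · rw [← Matrix.submatrix_mul _ _ _ _ _ Function.bijective_id]; simp
  · rw [← Matrix.submatrix_mul _ _ _ _ _ e.symm.bijective]; simp
  · rw [← Matrix.submatrix_mul _ _ _ _ _ e.symm.bijective]; simp
  · rw [← Matrix.submatrix_mul _ _ _ _ _ Function.bijective_id]; simp
  · refine Set.image_congr fun M _ => ?_
    ext i j
    simp [Matrix.mul_apply, Matrix.one_apply]

theorem rectEquiv_iff_equivSets {n : ℕ} {X Y : Set (Matrix (Fin n) (Fin n) K)} :
    RectEquiv X Y ↔ EquivSets X Y := by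
  constructor
  · rintro ⟨P, P', Q, Q', h1, h2, h3, h4, h⟩
    exact ⟨P, Q, ⟨⟨P, P', h1, h2⟩, rfl⟩, ⟨⟨Q, Q', h3, h4⟩, rfl⟩, h⟩
  · rintro ⟨_, _, ⟨P, rfl⟩, ⟨Q, rfl⟩, h⟩
    exact ⟨P.1, P.2, Q.1, Q.2, P.3, P.4, Q.3, Q.4, h⟩

/-- The set `1 + X`. -/
def onePlus (X : Set (Matrix ι ι K)) : Set (Matrix ι ι K) := (fun M => 1 + M) '' X

theorem onePlus_reindex {α β : Type*} [DecidableEq α] [DecidableEq β] (e : α ≃ β)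
    (X : Set (Matrix α α K)) :
    onePlus (Matrix.reindex e e '' X) = Matrix.reindex e e '' onePlus X := by
  rw [onePlus, onePlus, Set.image_image, Set.image_image]
  refine Set.image_congr fun M _ => ?_
  simp [Matrix.submatrix_add]

theorem rectEquiv_onePlus_reindex (e : ι ≃ κ) (X : Set (Matrix ι ι K)) :
    RectEquiv (onePlus X) (onePlus (Matrix.reindex e e '' X)) := by
  rw [onePlus_reindex]
  exact rectEquiv_reindex e _

theorem rectEquiv_onePlus_conj {S : Matrix κ ι K} {T : Matrix ι κ K} (h1 : S * T = 1)
    (h2 : T * S = 1) (X : Set (Matrix ι ι K)) :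
    RectEquiv (onePlus X) (onePlus ((fun M => S * M * T) '' X)) := by
  refine ⟨S, T, T, S, h1, h2, h2, h1, ?_⟩
  rw [onePlus, onePlus, Set.image_image, Set.image_image]
  refine Set.image_congr fun M _ => ?_
  rw [Matrix.mul_add, Matrix.add_mul, Matrix.mul_one, h1]

/-- Block upper-triangular matrices with diagonal blocks in `X` and `Y`. -/
def upperJoin (X : Set (Matrix ι ι K)) (Y : Set (Matrix κ κ K)) :
    Set (Matrix (ι ⊕ κ) (ι ⊕ κ) K) :=
  {M | ∃ A ∈ X, ∃ C ∈ Y, ∃ B : Matrix ι κ K, M = Matrix.fromBlocks A B 0 C}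

theorem onePlus_upperJoin {α β : Type*} [DecidableEq α] [DecidableEq β] (X : Set (Matrix α α K))
    (Y : Set (Matrix β β K)) :
    onePlus (upperJoin X Y) = upperJoin (onePlus X) (onePlus Y) := by
  ext M
  constructor
  · rintro ⟨_, ⟨A, hA, C, hC, B, rfl⟩, rfl⟩
    exact ⟨_, ⟨A, hA, rfl⟩, _, ⟨C, hC, rfl⟩, B, by
      simp [← Matrix.fromBlocks_one, Matrix.fromBlocks_add]⟩
  · rintro ⟨_, ⟨A, hA, rfl⟩, _, ⟨C, hC, rfl⟩, B, rfl⟩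
    exact ⟨_, ⟨A, hA, C, hC, B, rfl⟩, by
      simp [← Matrix.fromBlocks_one, Matrix.fromBlocks_add]⟩

theorem RectEquiv.upperJoin_congr {X : Set (Matrix ι ι K)} {X' : Set (Matrix ι' ι' K)}
    {Y : Set (Matrix κ κ K)} {Y' : Set (Matrix κ' κ' K)} (hX : RectEquiv X X')
    (hY : RectEquiv Y Y') : RectEquiv (upperJoin X Y) (upperJoin X' Y') := by
  obtain ⟨P, P', Q, Q', h1, h2, h3, h4, rfl⟩ := hX
  obtain ⟨R, R', S, S', k1, k2, k3, k4, rfl⟩ := hY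
  refine ⟨fromBlocks P 0 0 R, fromBlocks P' 0 0 R', fromBlocks Q 0 0 S, fromBlocks Q' 0 0 S',
    ?_, ?_, ?_, ?_, ?_⟩
  · simp [Matrix.fromBlocks_multiply, h1, k1]
  · simp [Matrix.fromBlocks_multiply, h2, k2]
  · simp [Matrix.fromBlocks_multiply, h3, k3]
  · simp [Matrix.fromBlocks_multiply, h4, k4]
  · ext M
    constructor
    · rintro ⟨_, ⟨A, hA, rfl⟩, _, ⟨C, hC, rfl⟩, B, rfl⟩
      refine ⟨fromBlocks A (P' * B * S') 0 C, ⟨A, hA, C, hC, _, rfl⟩, ?_⟩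
      have : P * (P' * B * S') * S = B := by
        rw [← Matrix.mul_assoc, ← Matrix.mul_assoc, h1, Matrix.one_mul, Matrix.mul_assoc, k4,
          Matrix.mul_one]
      simp [Matrix.fromBlocks_multiply, this]
    · rintro ⟨_, ⟨A, hA, C, hC, B, rfl⟩, rfl⟩
      exact ⟨_, ⟨A, hA, rfl⟩, _, ⟨C, hC, rfl⟩, P * B * S, by simp [Matrix.fromBlocks_multiply]⟩

/-- `P · Alt`. -/
def mulAlt {m : ℕ} (P : Matrix (Fin m) (Fin m) K) : Set (Matrix (Fin m) (Fin m) K) :=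
  (fun A => P * A) '' altSet K m

theorem rectEquiv_bdSet_cons (x : Σ m : ℕ, Matrix (Fin m) (Fin m) K)
    (xs : List (Σ m : ℕ, Matrix (Fin m) (Fin m) K)) :
    RectEquiv (upperJoin (onePlus (mulAlt x.2)) (onePlus (bdSet xs)))
      (onePlus (bdSet (x :: xs))) := by
  have : bdSet (x :: xs) =
      Matrix.reindex finSumFinEquiv finSumFinEquiv '' upperJoin (mulAlt x.2) (bdSet xs) := by
    ext M
    constructor
    · rintro ⟨A, hA, C, hC, B, rfl⟩
      exact ⟨_, ⟨A, hA, C, hC, B, rfl⟩, rfl⟩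
    · rintro ⟨_, ⟨A, hA, C, hC, B, rfl⟩, rfl⟩
      exact ⟨A, hA, C, hC, B, rfl⟩
  rw [this, ← onePlus_upperJoin]
  exact rectEquiv_onePlus_reindex _ _

theorem affRepresents_iff {n : ℕ} {𝒱 : Set (Matrix (Fin n) (Fin n) K)}
    {l : List (Σ m : ℕ, Matrix (Fin m) (Fin m) K)} : AffRepresents 𝒱 l ↔
      (∀ x ∈ l, 0 < x.1 ∧ IsUnit x.2 ∧ nonIsotropic x.2) ∧ RectEquiv (onePlus (bdSet l)) 𝒱 := by
  refine and_congr_right fun _ => ⟨?_, fun h => ?_⟩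
  · rintro ⟨h, h'⟩
    exact (rectEquiv_onePlus_reindex (finCongr h) _).trans (rectEquiv_iff_equivSets.2 h')
  · have hn : sigSum l = n := by simpa using h.card_eq
    exact ⟨hn, rectEquiv_iff_equivSets.1
      ((rectEquiv_onePlus_reindex (finCongr hn) _).symm.trans h)⟩

end RectEquiv

section Alternate

variable {K : Type*} [Field K] {m : ℕ}

/-- `altSet` as a submodule. -/
def altSubmodule (K : Type*) [Field K] (m : ℕ) : Submodule K (Matrix (Fin m) (Fin m) K) where
  carrier := altSet K m
  zero_mem' := fun X => by simp
  add_mem' := fun {A B} hA hB X => by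
    rw [Matrix.add_mulVec, dotProduct_add, hA X, hB X, add_zero]
  smul_mem' := fun c A hA X => by
    rw [Matrix.smul_mulVec, dotProduct_smul, hA X, smul_zero]

theorem mem_altSubmodule {A : Matrix (Fin m) (Fin m) K} :
    A ∈ altSubmodule K m ↔ A ∈ altSet K m := Iff.rfl

theorem congr_mem_altSet {p : ℕ} {A : Matrix (Fin m) (Fin m) K} (hA : A ∈ altSet K m)
    (R : Matrix (Fin p) (Fin m) K) : R * A * Rᵀ ∈ altSet K p := fun X => by
  have := hA (Rᵀ *ᵥ X)
  rw [Matrix.mul_assoc, ← Matrix.mulVec_mulVec, Matrix.dotProduct_mulVec, ← Matrix.mulVec_transpose,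
    ← Matrix.mulVec_mulVec]
  exact this

theorem sub_transpose_mem_altSet (P : Matrix (Fin m) (Fin m) K) : P - Pᵀ ∈ altSet K m := fun X => by
  rw [Matrix.sub_mulVec, dotProduct_sub, Matrix.mulVec_transpose, Matrix.dotProduct_mulVec,
    dotProduct_comm, sub_self]

theorem transpose_mem_altSet {A : Matrix (Fin m) (Fin m) K} (hA : A ∈ altSet K m) :
    Aᵀ ∈ altSet K m := fun X => by
  rw [Matrix.mulVec_transpose, dotProduct_comm, ← Matrix.dotProduct_mulVec]
  exact hA X

theorem isUnit_of_nonIsotropic {P : Matrix (Fin m) (Fin m) K} (hP : nonIsotropic P) : IsUnit P := by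
  rw [Matrix.isUnit_iff_isUnit_det, isUnit_iff_ne_zero]
  intro h0
  obtain ⟨v, hv, h⟩ := Matrix.exists_mulVec_eq_zero_iff.2 h0
  exact hP v hv (by rw [h, dotProduct_zero])

theorem det_one_add_mul_ne_zero {P A : Matrix (Fin m) (Fin m) K} (hP : nonIsotropic P)
    (hA : A ∈ altSet K m) : (1 + P * A).det ≠ 0 := by
  intro h0
  obtain ⟨v, hv, h⟩ := Matrix.exists_mulVec_eq_zero_iff.2 h0
  have h1 : v = P *ᵥ (-(A *ᵥ v)) := by
    rw [Matrix.add_mulVec, Matrix.one_mulVec, ← Matrix.mulVec_mulVec] at h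
    rw [Matrix.mulVec_neg]
    exact eq_neg_of_add_eq_zero_left h
  by_cases h2 : A *ᵥ v = 0
  · rw [h2, neg_zero, Matrix.mulVec_zero] at h1
    exact hv h1
  · refine hP (-(A *ᵥ v)) (neg_ne_zero.2 h2) ?_
    rw [← h1, neg_dotProduct, dotProduct_comm, hA v, neg_zero]

theorem det_ne_zero_of_isUnit {M : Matrix (Fin m) (Fin m) K} (hM : IsUnit M) : M.det ≠ 0 :=
  ((Matrix.isUnit_iff_isUnit_det M).1 hM).ne_zero

/-- The set `P + Alt`, equivalent to `1 + P Alt`. -/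
theorem rectEquiv_onePlus_mulAlt {P : Matrix (Fin m) (Fin m) K} (hP : IsUnit P) :
    RectEquiv (onePlus (mulAlt P)) ((fun A => P + A) '' altSet K m) := by
  obtain ⟨⟨P, P', h1, h2⟩, rfl⟩ := hP
  refine ⟨1, 1, Pᵀ, P'ᵀ, by simp, by simp, ?_, ?_, ?_⟩
  · rw [← transpose_mul, h2, transpose_one]
  · rw [← transpose_mul, h1, transpose_one]
  · ext M
    simp only [onePlus, mulAlt, Set.mem_image, exists_exists_and_eq_and, Matrix.one_mul,
      Matrix.add_mul]
    constructor
    · rintro ⟨A, hA, rfl⟩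
      refine ⟨P' * (P - Pᵀ + A) * P'ᵀ, congr_mem_altSet ?_ _, ?_⟩
      · exact (altSubmodule K m).add_mem (sub_transpose_mem_altSet P) hA
      · rw [Matrix.mul_assoc, Matrix.mul_assoc, Matrix.mul_assoc, ← transpose_mul, h1,
          transpose_one, Matrix.mul_one, ← Matrix.mul_assoc, h1, Matrix.one_mul]
        abel
    · rintro ⟨A, hA, rfl⟩
      refine ⟨Pᵀ - P + P * A * Pᵀ, ?_, by abel⟩
      refine (altSubmodule K m).add_mem ?_ (congr_mem_altSet hA P)
      simpa using (altSubmodule K m).neg_mem (sub_transpose_mem_altSet P)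

theorem rectEquiv_add_altSet {P Q R : Matrix (Fin m) (Fin m) K} {c : K} (hc : c ≠ 0)
    (hR : IsUnit R) (h : c • Q - R * P * Rᵀ ∈ altSet K m) :
    RectEquiv ((fun A => P + A) '' altSet K m) ((fun A => Q + A) '' altSet K m) := by
  obtain ⟨⟨R, R', h1, h2⟩, rfl⟩ := hR
  have h1' : R'ᵀ * Rᵀ = 1 := by rw [← transpose_mul, h1, transpose_one]
  have h2' : Rᵀ * R'ᵀ = 1 := by rw [← transpose_mul, h2, transpose_one]
  refine ⟨c⁻¹ • R, c • R', Rᵀ, R'ᵀ, by simp [hc, h1], by simp [hc, h2], h2', h1', ?_⟩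
  ext M
  simp only [Set.mem_image, exists_exists_and_eq_and]
  constructor
  · rintro ⟨A, hA, rfl⟩
    refine ⟨R' * ((c • Q - R * P * Rᵀ) + c • A) * R'ᵀ, congr_mem_altSet ?_ _, ?_⟩
    · exact (altSubmodule K m).add_mem h ((altSubmodule K m).smul_mem c hA)
    · have : P + R' * ((c • Q - R * P * Rᵀ) + c • A) * R'ᵀ = R' * (c • (Q + A)) * R'ᵀ := by
        have h3 : P = R' * (R * P * Rᵀ) * R'ᵀ := by
          rw [Matrix.mul_assoc, Matrix.mul_assoc, Matrix.mul_assoc, h2', Matrix.mul_one,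
            ← Matrix.mul_assoc, h2, Matrix.one_mul]
        nth_rw 1 [h3]
        rw [← Matrix.add_mul, ← Matrix.mul_add, smul_add]
        congr 2
        abel
      rw [this, Matrix.smul_mul, Matrix.smul_mul, Matrix.mul_assoc R', ← Matrix.mul_assoc R, h1,
        Matrix.one_mul, Matrix.mul_assoc, h1', Matrix.mul_one, smul_smul, inv_mul_cancel₀ hc,
        one_smul]
  · rintro ⟨A, hA, rfl⟩
    refine ⟨c⁻¹ • (R * A * Rᵀ - (c • Q - R * P * Rᵀ)), ?_, ?_⟩
    · exact (altSubmodule K m).smul_mem _ ((altSubmodule K m).sub_mem (congr_mem_altSet hA R) h)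
    · rw [sub_sub_eq_add_sub, smul_sub, smul_smul, inv_mul_cancel₀ hc, one_smul, Matrix.smul_mul,
        Matrix.smul_mul, Matrix.mul_add, Matrix.add_mul, add_comm (R * A * Rᵀ)]
      abel

theorem rectEquiv_of_qfSimilar {x y : Σ m : ℕ, Matrix (Fin m) (Fin m) K} (h : qfSimilar x y)
    (hx : IsUnit x.2) (hy : IsUnit y.2) :
    RectEquiv (onePlus (mulAlt x.2)) (onePlus (mulAlt y.2)) := by
  obtain ⟨m, P⟩ := x
  obtain ⟨p, Q⟩ := y
  obtain ⟨h, c, hc, R, hR, hmem⟩ := h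
  dsimp only at h
  subst h
  refine (rectEquiv_onePlus_mulAlt hx).trans (.trans ?_ (rectEquiv_onePlus_mulAlt hy).symm)
  exact rectEquiv_add_altSet hc hR (by simpa using hmem)

theorem rectEquiv_bdSet {l l' : List (Σ m : ℕ, Matrix (Fin m) (Fin m) K)}
    (h : List.Forall₂ qfSimilar l l') (hl : ∀ x ∈ l, IsUnit x.2) (hl' : ∀ x ∈ l', IsUnit x.2) :
    RectEquiv (onePlus (bdSet l)) (onePlus (bdSet l')) := by
  induction h with
  | nil => exact RectEquiv.refl _
  | cons hxy _ ih =>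
    simp only [List.mem_cons, forall_eq_or_imp] at hl hl'
    exact ((rectEquiv_bdSet_cons _ _).symm.trans
      ((rectEquiv_of_qfSimilar hxy hl.1 hl'.1).upperJoin_congr (ih hl.2 hl'.2))).trans
        (rectEquiv_bdSet_cons _ _)

end Alternate

section Structure

variable {K : Type*} [Field K] {m : ℕ}

/-- A square matrix `M` acting on `K^m` through its transpose. -/
def transposeEnd (K : Type*) [Field K] (m : ℕ) :
    Matrix (Fin m) (Fin m) K ≃ₗ[K] End K (Fin m → K) :=
  (Matrix.transposeLinearEquiv (Fin m) (Fin m) K K).trans Matrix.toLin'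

theorem trivialSpectrum_map_transposeEnd {V : Submodule K (Matrix (Fin m) (Fin m) K)}
    (hV : ∀ M ∈ V, (1 + M).det ≠ 0) :
    TrivialSpectrum (V.map (transposeEnd K m).toLinearMap) := by
  rintro _ ⟨M, hM, rfl⟩ x hx
  by_contra hx0
  refine hV (-M) (V.neg_mem hM) ?_
  rw [← Matrix.det_transpose]
  refine Matrix.exists_mulVec_eq_zero_iff.1 ⟨x, hx0, ?_⟩
  change Mᵀ *ᵥ x = x at hx
  rw [transpose_add, transpose_neg, transpose_one, Matrix.add_mulVec, Matrix.neg_mulVec, hx,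
    Matrix.one_mulVec, add_neg_cancel]

theorem finrank_map_transposeEnd (V : Submodule K (Matrix (Fin m) (Fin m) K)) :
    finrank K (V.map (transposeEnd K m).toLinearMap) = finrank K V :=
  LinearEquiv.finrank_map_eq (transposeEnd K m) V

theorem finrank_le_choose_two {V : Submodule K (Matrix (Fin m) (Fin m) K)}
    (hV : ∀ M ∈ V, (1 + M).det ≠ 0) : finrank K V ≤ m.choose 2 := by
  rw [← finrank_map_transposeEnd]
  exact TrivialSpectrum.finrank_le m (by simp) (trivialSpectrum_map_transposeEnd hV)

theorem finrank_altSubmodule_le {P : Matrix (Fin m) (Fin m) K} (hP : nonIsotropic P) :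
    finrank K (altSubmodule K m) ≤ m.choose 2 := by
  obtain ⟨P', hP'⟩ := (isUnit_of_nonIsotropic hP).exists_left_inv
  have hinj : Function.Injective (LinearMap.mulLeft K P) := fun A B h => by
    have : P' * (P * A) = P' * (P * B) := congrArg (P' * ·) h
    rwa [← Matrix.mul_assoc, ← Matrix.mul_assoc, hP', Matrix.one_mul, Matrix.one_mul] at this
  rw [(Submodule.equivMapOfInjective (LinearMap.mulLeft K P) hinj (altSubmodule K m)).finrank_eq]
  refine finrank_le_choose_two ?_
  rintro _ ⟨A, hA, rfl⟩
  exact det_one_add_mul_ne_zero hP hA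

theorem exists_basis_of_form (b : (Fin m → K) →ₗ[K] Dual K (Fin m → K)) (hb : b ≠ 0)
    (haniso : ∀ x, b x x = 0 → b x = 0) :
    ∃ (r s : ℕ) (u : Basis (Fin r ⊕ Fin s) K (Fin m → K)), 0 < r ∧ (∀ j, b (u (Sum.inr j)) = 0) ∧
      ∀ c : Fin r → K, b (∑ i, c i • u (Sum.inl i)) (∑ i, c i • u (Sum.inl i)) = 0 → c = 0 := by
  obtain ⟨G, hG⟩ := Submodule.exists_isCompl (LinearMap.ker b)
  let u := ((finBasis K G).prod (finBasis K (LinearMap.ker b))).map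
    (Submodule.prodEquivOfIsCompl G _ hG.symm)
  have hul : ∀ i, u (Sum.inl i) = (finBasis K G i : Fin m → K) := fun i => by simp [u]
  have hur : ∀ j, u (Sum.inr j) = (finBasis K (LinearMap.ker b) j : Fin m → K) := fun j => by
    simp [u]
  refine ⟨_, _, u, ?_, fun j => ?_, fun c hc => ?_⟩
  · rw [Nat.pos_iff_ne_zero, Ne, Submodule.finrank_eq_zero]
    rintro rfl
    refine hb (LinearMap.ker_eq_top.1 ?_)
    simpa using hG.sup_eq_top
  · rw [hur]
    exact (finBasis K (LinearMap.ker b) j).2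
  · have h1 : ∑ i, c i • u (Sum.inl i) = ((∑ i, c i • finBasis K G i : G) : Fin m → K) := by
      simp [hul]
    have h2 : (∑ i, c i • u (Sum.inl i)) ∈ LinearMap.ker b ⊓ G :=
      ⟨haniso _ hc, by rw [h1]; exact Subtype.prop _⟩
    rw [hG.inf_eq_bot, Submodule.mem_bot] at h2
    have hli : LinearIndependent K fun i => u (Sum.inl i) :=
      u.linearIndependent.comp _ Sum.inl_injective
    exact funext fun i => Fintype.linearIndependent_iff.1 hli c h2 i

theorem mem_altSet_of_fromBlocks {r s : ℕ} {P M₁ : Matrix (Fin r) (Fin r) K}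
    {X : Matrix (Fin r) (Fin s) K} {M₃ : Matrix (Fin s) (Fin r) K} {C : Matrix (Fin s) (Fin s) K}
    (hP : nonIsotropic P)
    (h : ∀ y, y ⬝ᵥ (fromBlocks P 0 0 0 * (fromBlocks M₁ X M₃ C)ᵀ) *ᵥ y = 0) :
    M₃ = 0 ∧ ∃ A ∈ altSet K r, M₁ = P * A := by
  obtain ⟨⟨P, P', h1, h2⟩, rfl⟩ := isUnit_of_nonIsotropic hP
  dsimp only at h hP ⊢
  have key : ∀ (y₁ : Fin r → K) (y₂ : Fin s → K),
      y₁ ⬝ᵥ (P * M₁ᵀ) *ᵥ y₁ + y₁ ⬝ᵥ (P * M₃ᵀ) *ᵥ y₂ = 0 := fun y₁ y₂ => by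
    have := h (Sum.elim y₁ y₂)
    rw [fromBlocks_transpose, fromBlocks_multiply, fromBlocks_mulVec] at this
    simpa [dotProduct_add, sumElim_dotProduct_sumElim] using this
  have halt : P * M₁ᵀ ∈ altSet K r := fun y => by simpa using key y 0
  constructor
  · have h3 : P * M₃ᵀ = 0 := by
      ext i j
      have := key (Pi.single i 1) (Pi.single j 1)
      rw [halt, zero_add] at this
      simpa using this
    have h4 : P' * (P * M₃ᵀ) = 0 := by rw [h3, Matrix.mul_zero]
    rw [← Matrix.mul_assoc, h2, Matrix.one_mul] at h4
    exact transpose_eq_zero.1 h4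
  · refine ⟨P' * (P * M₁ᵀ)ᵀ * P'ᵀ, congr_mem_altSet (transpose_mem_altSet halt) _, ?_⟩
    rw [transpose_mul, transpose_transpose, Matrix.mul_assoc, Matrix.mul_assoc, ← transpose_mul,
      h2, transpose_one, Matrix.mul_one, ← Matrix.mul_assoc, h1, Matrix.one_mul]

/-- Block-triangular reduction given by the adapted form. -/
theorem exists_block_reduction {τ : K} (hτ0 : τ ≠ 0) (hτ1 : τ ≠ 1) (hm : 0 < m)
    {V : Submodule K (Matrix (Fin m) (Fin m) K)} (hV : ∀ M ∈ V, (1 + M).det ≠ 0)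
    (hdim : finrank K V = m.choose 2) :
    ∃ (r s : ℕ) (S : Matrix (Fin r ⊕ Fin s) (Fin m) K) (T : Matrix (Fin m) (Fin r ⊕ Fin s) K)
      (P : Matrix (Fin r) (Fin r) K), 0 < r ∧ S * T = 1 ∧ T * S = 1 ∧ nonIsotropic P ∧
      ∀ M ∈ V, ∃ A ∈ altSet K r, ∃ X C, S * M * T = fromBlocks (P * A) X 0 C := by
  obtain ⟨n, rfl⟩ : ∃ n, m = n + 1 := ⟨m - 1, by omega⟩
  obtain ⟨b, hb⟩ := IsMaxTrivialSpectrum.exists_isAdaptedForm hτ0 hτ1 n (by simp)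
    (V := V.map (transposeEnd K (n + 1)).toLinearMap)
    ⟨trivialSpectrum_map_transposeEnd hV, by rw [finrank_map_transposeEnd, hdim]; simp⟩
  obtain ⟨r, s, u, hr, hur, hul⟩ := exists_basis_of_form b hb.ne_zero hb.anisotropic
  let B : Matrix (Fin (n + 1)) (Fin (n + 1)) K := LinearMap.toMatrix₂' K b
  have hB : ∀ x y, b x y = x ⬝ᵥ B *ᵥ y := fun x y => by
    rw [← Matrix.toLinearMap₂'_apply', Matrix.toLinearMap₂'_toMatrix']
  let S := ((Pi.basisFun K (Fin (n + 1))).toMatrix u)ᵀ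
  let T := (u.toMatrix (Pi.basisFun K (Fin (n + 1))))ᵀ
  have hST : S * T = 1 := by
    rw [← transpose_mul, Basis.toMatrix_mul_toMatrix_flip, transpose_one]
  have hTS : T * S = 1 := by
    rw [← transpose_mul, Basis.toMatrix_mul_toMatrix_flip, transpose_one]
  have hS : ∀ y, Sᵀ *ᵥ y = ∑ i, y i • u i := fun y => by
    ext k
    simp [S, mulVec, dotProduct, Basis.toMatrix_apply, mul_comm]
  have hB' : ∀ y w, y ⬝ᵥ (S * B * Sᵀ) *ᵥ w = b (∑ i, y i • u i) (∑ i, w i • u i) := fun y w => by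
    rw [hB, ← hS, ← hS, Matrix.mul_assoc, ← Matrix.mulVec_mulVec, Matrix.dotProduct_mulVec,
      ← Matrix.mulVec_transpose, ← Matrix.mulVec_mulVec]
  have hentry : ∀ i j, (S * B * Sᵀ) i j = b (u i) (u j) := fun i j => by
    have := hB' (Pi.single i 1) (Pi.single j 1)
    simpa [Pi.single_apply] using this
  have hblock : S * B * Sᵀ = fromBlocks (S * B * Sᵀ).toBlocks₁₁ 0 0 0 := by
    ext i j
    rcases i with i | i <;> rcases j with j | j
    · rfl
    · rw [hentry, hb.radical _ (hur j)]; rfl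
    · rw [hentry, hur]; rfl
    · rw [hentry, hur]; rfl
  have hP : nonIsotropic (S * B * Sᵀ).toBlocks₁₁ := fun c hc h0 => hc (hul c ?_)
  · refine ⟨r, s, S, T, _, hr, hST, hTS, hP, fun M hM => ?_⟩
    rw [← fromBlocks_toBlocks (S * M * T)]
    obtain ⟨h1, A, hA, h2⟩ := mem_altSet_of_fromBlocks (M₁ := (S * M * T).toBlocks₁₁)
      (X := (S * M * T).toBlocks₁₂) (M₃ := (S * M * T).toBlocks₂₁) (C := (S * M * T).toBlocks₂₂)
      hP (fun y => by
        rw [fromBlocks_toBlocks, ← hblock]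
        have h3 : S * B * Sᵀ * (S * M * T)ᵀ = S * (B * Mᵀ) * Sᵀ := by
          have h4 : Sᵀ * Tᵀ = 1 := by rw [← transpose_mul, hTS, transpose_one]
          rw [transpose_mul, transpose_mul, ← Matrix.mul_assoc, Matrix.mul_assoc _ Sᵀ, h4,
            Matrix.mul_one, ← Matrix.mul_assoc, ← Matrix.mul_assoc]
        rw [h3, Matrix.mul_assoc, ← Matrix.mulVec_mulVec, Matrix.dotProduct_mulVec,
          ← Matrix.mulVec_transpose, ← Matrix.mulVec_mulVec, ← Matrix.mulVec_mulVec, ← hB]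
        exact hb.alternating _ ⟨M, hM, rfl⟩ _)
    exact ⟨A, hA, _, _, by rw [h1, h2]⟩
  · have h1 := hB' (Sum.elim c 0) (Sum.elim c 0)
    rw [hblock, fromBlocks_mulVec] at h1
    simp only [Fintype.sum_sum_type, Sum.elim_inl, Sum.elim_inr, Pi.zero_apply, zero_smul,
      Finset.sum_const_zero, add_zero] at h1
    rw [← h1]
    simpa [sumElim_dotProduct_sumElim] using h0

theorem add_choose_two (r s : ℕ) : (r + s).choose 2 = r.choose 2 + r * s + s.choose 2 := by
  induction s with
  | zero => simp
  | succ s ih =>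
    rw [← add_assoc, Nat.choose_succ_succ' (r + s), Nat.choose_succ_succ' s, Nat.choose_one_right,
      Nat.choose_one_right, ih]
    ring

theorem exists_rectEquiv_bdSet {τ : K} (hτ0 : τ ≠ 0) (hτ1 : τ ≠ 1) (m : ℕ) :
    ∀ V : Submodule K (Matrix (Fin m) (Fin m) K), (∀ M ∈ V, (1 + M).det ≠ 0) →
      finrank K V = m.choose 2 → ∃ l : List (Σ m : ℕ, Matrix (Fin m) (Fin m) K),
        (∀ x ∈ l, 0 < x.1 ∧ IsUnit x.2 ∧ nonIsotropic x.2) ∧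
        RectEquiv (onePlus (bdSet l)) (onePlus (V : Set (Matrix (Fin m) (Fin m) K))) := by
  induction m using Nat.strong_induction_on with
  | _ m ih =>
  intro V hV hdim
  rcases Nat.eq_zero_or_pos m with rfl | hm
  · refine ⟨[], by simp, ?_⟩
    have : onePlus (V : Set (Matrix (Fin 0) (Fin 0) K)) =
        onePlus (bdSet ([] : List (Σ m : ℕ, Matrix (Fin m) (Fin m) K))) := by
      congr 1
      ext M
      simp only [SetLike.mem_coe, Subsingleton.elim M 0, zero_mem, true_iff]
      trivial
    rw [this]
    exact RectEquiv.refl _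
  obtain ⟨r, s, S, T, P, hr, hST, hTS, hP, hred⟩ := exists_block_reduction hτ0 hτ1 hm hV hdim
  have hcard : m = r + s := by simpa using card_eq_of_mul_eq_one hST hTS
  let Λ : Matrix (Fin m) (Fin m) K →ₗ[K] Matrix (Fin r ⊕ Fin s) (Fin r ⊕ Fin s) K :=
    { toFun := fun M => S * M * T
      map_add' := fun A B => by rw [Matrix.mul_add, Matrix.add_mul]
      map_smul' := fun c A => by rw [Matrix.mul_smul, Matrix.smul_mul]; rfl }
  have hΛinj : Function.Injective Λ := fun A B h => by
    have h1 : T * (S * A * T) * S = T * (S * B * T) * S := congrArg (fun X => T * X * S) h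
    simpa [← Matrix.mul_assoc, hTS, Matrix.mul_assoc _ T S] using h1
  let Γ : Matrix (Fin m) (Fin m) K →ₗ[K] Matrix (Fin s) (Fin s) K :=
    { toFun := fun M => (Λ M).toBlocks₂₂
      map_add' := fun A B => by rw [map_add]; rfl
      map_smul' := fun c A => by rw [map_smul]; rfl }
  have hV₂ : ∀ C ∈ V.map Γ, (1 + C).det ≠ 0 := by
    rintro _ ⟨M, hM, rfl⟩
    obtain ⟨A, hA, X, C, h⟩ := hred M hM
    have h1 : (1 + S * M * T).det ≠ 0 := by
      have h2 : 1 + S * M * T = S * (1 + M) * T := by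
        rw [Matrix.mul_add, Matrix.add_mul, Matrix.mul_one, hST]
      have h3 : S * (1 + M) * T * (S * (1 + M)⁻¹ * T) = 1 := by
        rw [Matrix.mul_assoc, ← Matrix.mul_assoc T, ← Matrix.mul_assoc T, hTS, Matrix.one_mul,
          ← Matrix.mul_assoc, Matrix.mul_assoc S, Matrix.mul_nonsing_inv _ (hV M hM).isUnit,
          Matrix.mul_one, hST]
      rw [h2]
      exact left_ne_zero_of_mul (b := (S * (1 + M)⁻¹ * T).det) (by
        rw [← Matrix.det_mul, h3, Matrix.det_one]; exact one_ne_zero)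
    have h2 : Γ M = C := by
      change (S * M * T).toBlocks₂₂ = C
      rw [h, toBlocks_fromBlocks₂₂]
    rw [h, ← fromBlocks_one, fromBlocks_add, add_zero, det_fromBlocks_zero₂₁] at h1
    rw [h2]
    exact right_ne_zero_of_mul h1
  let Φ : (altSubmodule K r × Matrix (Fin r) (Fin s) K) × V.map Γ →ₗ[K]
      Matrix (Fin r ⊕ Fin s) (Fin r ⊕ Fin s) K :=
    { toFun := fun p => fromBlocks (P * p.1.1.1) p.1.2 0 p.2.1
      map_add' := fun p q => by simp [fromBlocks_add, Matrix.mul_add]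
      map_smul' := fun c p => by simp [fromBlocks_smul] }
  have hle : V.map Λ ≤ LinearMap.range Φ := by
    rintro _ ⟨M, hM, rfl⟩
    obtain ⟨A, hA, X, C, h⟩ := hred M hM
    have h2 : Γ M = C := by
      change (S * M * T).toBlocks₂₂ = C
      rw [h, toBlocks_fromBlocks₂₂]
    refine ⟨((⟨A, hA⟩, X), ⟨Γ M, M, hM, rfl⟩), ?_⟩
    change fromBlocks (P * A) X 0 (Γ M) = S * M * T
    rw [h, h2]
  have hdimΛ : finrank K (V.map Λ) = m.choose 2 := by
    rw [← hdim, (Submodule.equivMapOfInjective Λ hΛinj V).finrank_eq]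
  have hdimΦ : finrank K (LinearMap.range Φ) ≤
      finrank K (altSubmodule K r) + r * s + finrank K (V.map Γ) := by
    refine (LinearMap.finrank_range_le Φ).trans ?_
    rw [finrank_prod, finrank_prod, finrank_matrix]
    simp
  have hchoose : m.choose 2 = r.choose 2 + r * s + s.choose 2 := by
    rw [hcard, add_choose_two]
  have halt := finrank_altSubmodule_le hP
  have hΓ := finrank_le_choose_two hV₂
  have hΓ' : finrank K (V.map Γ) = s.choose 2 := by
    have := Submodule.finrank_mono hle
    omega
  have heq : V.map Λ = LinearMap.range Φ :=
    Submodule.eq_of_le_of_finrank_le hle (by omega)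
  obtain ⟨xs, hxs, hxsV⟩ := ih s (by omega) _ hV₂ hΓ'
  refine ⟨⟨r, P⟩ :: xs, ?_, ?_⟩
  · simp only [List.mem_cons, forall_eq_or_imp]
    exact ⟨⟨hr, isUnit_of_nonIsotropic hP, hP⟩, hxs⟩
  · refine (rectEquiv_bdSet_cons _ _).symm.trans
      (((RectEquiv.refl (onePlus (mulAlt P))).upperJoin_congr hxsV).trans ?_)
    have : upperJoin (mulAlt P) (V.map Γ : Set (Matrix (Fin s) (Fin s) K)) =
        (fun M => S * M * T) '' (V : Set (Matrix (Fin m) (Fin m) K)) := by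
      have h1 : (fun M => S * M * T) '' (V : Set (Matrix (Fin m) (Fin m) K)) = V.map Λ := rfl
      rw [h1, heq]
      ext M
      constructor
      · rintro ⟨_, ⟨A, hA, rfl⟩, C, hC, X, rfl⟩
        exact ⟨((⟨A, hA⟩, X), ⟨C, hC⟩), rfl⟩
      · rintro ⟨⟨⟨⟨A, hA⟩, X⟩, ⟨C, hC⟩⟩, rfl⟩
        exact ⟨_, ⟨A, hA, rfl⟩, C, hC, X, rfl⟩
    rw [← onePlus_upperJoin, this]
    exact (rectEquiv_onePlus_conj hST hTS _).symm

end Structure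

section Uniqueness

variable {K : Type*} [Field K]

theorem exists_altSet_mulVec_eq {m : ℕ} {x w : Fin m → K} (hx : x ≠ 0) (hw : x ⬝ᵥ w = 0) :
    ∃ A ∈ altSet K m, A *ᵥ x = w := by
  obtain ⟨i, hi⟩ : ∃ i, x i ≠ 0 := Function.ne_iff.1 hx
  refine ⟨(x i)⁻¹ • (vecMulVec w (Pi.single i 1) - vecMulVec (Pi.single i 1) w),
    (altSubmodule K m).smul_mem _ fun y => ?_, ?_⟩
  · simp [Matrix.sub_mulVec, Matrix.vecMulVec_mulVec, dotProduct_comm w y, mul_comm]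
  · ext j
    simp [Matrix.sub_mulVec, Matrix.vecMulVec_mulVec, Matrix.smul_mulVec, dotProduct_comm w x, hw,
      hi]

theorem exists_eq_smul_of_forall_dotProduct {m : ℕ} {x y : Fin m → K}
    (h : ∀ w, x ⬝ᵥ w = 0 → w ⬝ᵥ y = 0) : ∃ c : K, y = c • x := by
  by_cases hx : x = 0
  · subst hx
    refine ⟨0, ?_⟩
    ext j
    simpa using h (Pi.single j 1) (by simp)
  obtain ⟨i, hi⟩ : ∃ i, x i ≠ 0 := Function.ne_iff.1 hx
  refine ⟨y i / x i, ?_⟩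
  ext j
  have := h (x i • Pi.single j 1 - x j • Pi.single i 1) (by simp [dotProduct_sub, mul_comm])
  simp only [sub_dotProduct, smul_dotProduct, single_dotProduct, one_mul, smul_eq_mul] at this
  simp only [Pi.smul_apply, smul_eq_mul]
  field_simp
  linear_combination this

theorem exists_eq_smul_one_of_mul_mem_altSet {m : ℕ} {Z : Matrix (Fin m) (Fin m) K}
    (h : ∀ A ∈ altSet K m, A * Z ∈ altSet K m) :
    ∃ c : K, Z = c • (1 : Matrix (Fin m) (Fin m) K) := by
  have heig : ∀ x, ∃ c : K, Z *ᵥ x = c • x := by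
    intro x
    by_cases hx : x = 0
    · exact ⟨0, by simp [hx]⟩
    refine exists_eq_smul_of_forall_dotProduct fun w hw => ?_
    obtain ⟨A, hA, rfl⟩ := exists_altSet_mulVec_eq hx hw
    have := h _ (transpose_mem_altSet hA) x
    rwa [← Matrix.mulVec_mulVec, Matrix.mulVec_transpose, dotProduct_comm,
      ← Matrix.dotProduct_mulVec, dotProduct_comm] at this
  obtain ⟨c, hc⟩ := LinearMap.exists_eq_smul_id_of_forall_notLinearIndependent
    (f := Matrix.toLin' Z) fun x hx => by
      obtain ⟨c, hc⟩ := heig x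
      have := (LinearIndependent.pair_iff.1 hx c (-1) (by
        rw [Matrix.toLin'_apply, hc, neg_one_smul, add_neg_cancel])).2
      exact one_ne_zero (neg_eq_zero.1 this)
  refine ⟨c, Matrix.toLin'.injective ?_⟩
  rw [hc, map_smul, Matrix.toLin'_one]
  rfl

theorem qfSimilar_of_rectEquiv {x y : Σ m : ℕ, Matrix (Fin m) (Fin m) K} (hx0 : 0 < x.1)
    (hx : IsUnit x.2) (hy : IsUnit y.2)
    (h : RectEquiv (onePlus (mulAlt x.2)) (onePlus (mulAlt y.2))) : qfSimilar x y := by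
  obtain ⟨m, P⟩ := x
  obtain ⟨p, Q⟩ := y
  dsimp only at *
  obtain rfl : m = p := by simpa using h.card_eq
  obtain ⟨U, U', W, W', h1, h2, h3, h4, h5⟩ :=
    ((rectEquiv_onePlus_mulAlt hx).symm.trans h).trans (rectEquiv_onePlus_mulAlt hy)
  have hmem : ∀ A ∈ altSet K m, U * (P + A) * W - Q ∈ altSet K m := by
    intro A hA
    have : U * (P + A) * W ∈ (fun A => Q + A) '' altSet K m := h5 ▸ ⟨_, ⟨A, hA, rfl⟩, rfl⟩
    obtain ⟨B, hB, hBe⟩ := this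
    rw [← hBe, add_sub_cancel_left]
    exact hB
  have hmem0 := hmem 0 (altSubmodule K m).zero_mem
  rw [add_zero] at hmem0
  have hU : U'ᵀ * Uᵀ = 1 := by rw [← transpose_mul, h1, transpose_one]
  obtain ⟨c, hc⟩ := exists_eq_smul_one_of_mul_mem_altSet (Z := W * U'ᵀ) fun A hA => by
    have h6 : U * A * W ∈ altSet K m := by
      have := (altSubmodule K m).sub_mem (hmem A hA) hmem0
      rwa [Matrix.mul_add, Matrix.add_mul, sub_sub_sub_cancel_right, add_sub_cancel_left] at this
    have h7 := congr_mem_altSet h6 U'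
    rwa [Matrix.mul_assoc U, ← Matrix.mul_assoc U', h2, Matrix.one_mul, Matrix.mul_assoc] at h7
  have hW : W = c • Uᵀ := by
    have := congrArg (· * Uᵀ) hc
    simpa [Matrix.mul_assoc, hU] using this
  have hc0 : c ≠ 0 := by
    rintro rfl
    have := congrFun (congrFun h4 ⟨0, hx0⟩) ⟨0, hx0⟩
    rw [hW] at this
    simp at this
  refine ⟨rfl, c⁻¹, inv_ne_zero hc0, U, ⟨⟨U, U', h1, h2⟩, rfl⟩, ?_⟩
  have := (altSubmodule K m).smul_mem (-c⁻¹) hmem0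
  rw [hW, Matrix.mul_smul, smul_sub, smul_smul, neg_mul, inv_mul_cancel₀ hc0] at this
  have h8 : (-1 : K) • (U * P * Uᵀ) - -c⁻¹ • Q = c⁻¹ • Q - U * P * Uᵀ := by
    module
  rw [h8] at this
  simpa using mem_altSubmodule.1 this

variable {ι κ ι' κ' : Type*} [Fintype ι] [Fintype κ] [Fintype ι'] [Fintype κ']

/-- Every non-zero vector is sent by `X` to a spanning family. -/
def SpansAll (X : Set (Matrix ι ι K)) : Prop :=
  ∀ x : ι → K, x ≠ 0 → ∀ F : Submodule K (ι → K), (∀ M ∈ X, M *ᵥ x ∈ F) → F = ⊤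

theorem spansAll_onePlus_mulAlt {m : ℕ} {P : Matrix (Fin m) (Fin m) K} (hP : nonIsotropic P) :
    SpansAll (onePlus (mulAlt P)) := by
  obtain ⟨⟨P, P', h1, h2⟩, rfl⟩ := isUnit_of_nonIsotropic hP
  dsimp only at *
  intro x hx F hF
  have hxF : x ∈ F := by
    simpa using hF _ ⟨_, ⟨0, (altSubmodule K m).zero_mem, rfl⟩, rfl⟩
  have hPF : ∀ w, x ⬝ᵥ w = 0 → P *ᵥ w ∈ F := by
    intro w hw
    obtain ⟨A, hA, rfl⟩ := exists_altSet_mulVec_eq hx hw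
    have := F.sub_mem (hF _ ⟨_, ⟨A, hA, rfl⟩, rfl⟩) hxF
    simpa [Matrix.add_mulVec] using this
  have hne : x ⬝ᵥ P' *ᵥ x ≠ 0 := by
    have h3 : P *ᵥ (P' *ᵥ x) = x := by rw [Matrix.mulVec_mulVec, h1, Matrix.one_mulVec]
    have := hP (P' *ᵥ x) (by intro h0; rw [h0, Matrix.mulVec_zero] at h3; exact hx h3.symm)
    rwa [h3, dotProduct_comm] at this
  rw [Submodule.eq_top_iff']
  intro v
  have h4 := hPF (P' *ᵥ (v - ((x ⬝ᵥ P' *ᵥ v) / (x ⬝ᵥ P' *ᵥ x)) • x)) (by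
    rw [Matrix.mulVec_sub, Matrix.mulVec_smul, dotProduct_sub, dotProduct_smul, smul_eq_mul,
      div_mul_cancel₀ _ hne, sub_self])
  rw [Matrix.mulVec_mulVec, h1, Matrix.one_mulVec] at h4
  simpa using F.add_mem h4 (F.smul_mem ((x ⬝ᵥ P' *ᵥ v) / (x ⬝ᵥ P' *ᵥ x)) hxF)

theorem mem_of_forall_upperJoin [DecidableEq κ] {X : Set (Matrix ι ι K)} {Y : Set (Matrix κ κ K)}
    (hX : SpansAll X) (hX0 : X.Nonempty) (hY0 : Y.Nonempty) {x : ι ⊕ κ → K} (hx : x ≠ 0)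
    {F : Submodule K (ι ⊕ κ → K)} (hF : ∀ M ∈ upperJoin X Y, M *ᵥ x ∈ F) (v : ι → K) :
    Sum.elim v 0 ∈ F := by
  obtain ⟨A, hA⟩ := hX0
  obtain ⟨C, hC⟩ := hY0
  have hJ : ∀ A ∈ X, ∀ B, Sum.elim (A *ᵥ (x ∘ Sum.inl) + B *ᵥ (x ∘ Sum.inr)) (C *ᵥ (x ∘ Sum.inr))
      ∈ F := fun A hA B => by
    have := hF _ ⟨A, hA, C, hC, B, rfl⟩
    rw [fromBlocks_mulVec] at this
    simpa using this
  by_cases hx2 : x ∘ Sum.inr = 0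
  · have hx1 : x ∘ Sum.inl ≠ 0 := by
      intro hx1
      refine hx (funext fun i => ?_)
      rcases i with i | i
      · exact congrFun hx1 i
      · exact congrFun hx2 i
    let L : (ι → K) →ₗ[K] (ι ⊕ κ → K) :=
      { toFun := fun v => Sum.elim v 0
        map_add' := fun a b => by ext (i | i) <;> simp
        map_smul' := fun a b => by ext (i | i) <;> simp }
    have := hX _ hx1 (F.comap L) fun M hM => by
      have := hJ M hM 0
      rw [hx2, Matrix.mulVec_zero, Matrix.mulVec_zero, add_zero] at this
      exact this
    have hv : v ∈ F.comap L := this ▸ Submodule.mem_top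
    exact hv
  · obtain ⟨i, hi⟩ : ∃ i, (x ∘ Sum.inr) i ≠ 0 := Function.ne_iff.1 hx2
    have h1 := F.sub_mem (hJ A hA (((x ∘ Sum.inr) i)⁻¹ • vecMulVec v (Pi.single i 1))) (hJ A hA 0)
    convert h1 using 1
    ext (j | j)
    · simp only [Function.comp_apply] at hi
      simp [Matrix.vecMulVec_mulVec, Matrix.smul_mulVec, hi]
    · simp

theorem mulVec_apply_inr_of_mem_upperJoin {α β : Type*} [Fintype α] [Fintype β]
    {X : Set (Matrix α α K)} {Y : Set (Matrix β β K)} {M : Matrix (α ⊕ β) (α ⊕ β) K}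
    (hM : M ∈ upperJoin X Y) (v : α → K) (j : β) :
    (M *ᵥ Sum.elim v 0) (Sum.inr j) = 0 := by
  obtain ⟨A, -, C, -, B, rfl⟩ := hM
  simp [fromBlocks_mulVec]

/-- The vectors with zero second block. -/
def firstBlock (K ι κ : Type*) [Field K] : Submodule K (ι ⊕ κ → K) where
  carrier := {x | ∀ j, x (Sum.inr j) = 0}
  zero_mem' := fun _ => rfl
  add_mem' := fun ha hb j => by simp [ha j, hb j]
  smul_mem' := fun c _ ha j => by simp [ha j]

theorem toBlocks₂₁_eq_zero [DecidableEq ι] {α β : Type*} {P : Matrix (α ⊕ β) (ι ⊕ κ) K}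
    (h : ∀ v, P *ᵥ Sum.elim v 0 ∈ firstBlock K α β) : P.toBlocks₂₁ = 0 := by
  ext i j
  have := h (Pi.single j 1) i
  rw [← fromBlocks_toBlocks P, fromBlocks_mulVec, Sum.elim_comp_inl, Sum.elim_comp_inr] at this
  simpa using this

theorem left_mulVec_mem_firstBlock [DecidableEq κ] [DecidableEq ι'] [DecidableEq κ'] [Nonempty ι']
    {X : Set (Matrix ι ι K)} {Y : Set (Matrix κ κ K)} {X' : Set (Matrix ι' ι' K)}
    {Y' : Set (Matrix κ' κ' K)} (hX : SpansAll X) (hX0 : X.Nonempty)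
    (hY0 : Y.Nonempty) {P : Matrix (ι' ⊕ κ') (ι ⊕ κ) K} {Q : Matrix (ι ⊕ κ) (ι' ⊕ κ') K}
    {Q' : Matrix (ι' ⊕ κ') (ι ⊕ κ) K} (hQ : Q' * Q = 1)
    (h : ∀ M ∈ upperJoin X Y, P * M * Q ∈ upperJoin X' Y') (v : ι → K) :
    P *ᵥ Sum.elim v 0 ∈ firstBlock K ι' κ' := by
  obtain ⟨i⟩ := ‹Nonempty ι'›
  have hne : Q *ᵥ Sum.elim (Pi.single i 1) 0 ≠ 0 := by
    intro h0
    have h1 := congrArg (Q' *ᵥ ·) h0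
    simp only [Matrix.mulVec_mulVec, hQ, Matrix.one_mulVec, Matrix.mulVec_zero] at h1
    simpa using congrFun h1 (Sum.inl i)
  refine mem_of_forall_upperJoin hX hX0 hY0 hne (F := (firstBlock K ι' κ').comap P.mulVecLin)
    (fun M hM j => ?_) v
  rw [Matrix.mulVecLin_apply, Matrix.mulVec_mulVec, Matrix.mulVec_mulVec]
  exact mulVec_apply_inr_of_mem_upperJoin (h M hM) _ j

theorem mem_firstBlock_iff {α β : Type*} {x : α ⊕ β → K} :
    x ∈ firstBlock K α β ↔ x = Sum.elim (x ∘ Sum.inl) 0 := by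
  constructor
  · intro h
    ext (i | i)
    · rfl
    · exact h i
  · intro h j
    rw [h]
    rfl

theorem right_mulVec_mem_firstBlock [DecidableEq ι] [DecidableEq κ]
    {X : Set (Matrix ι ι K)} {Y : Set (Matrix κ κ K)} {X' : Set (Matrix ι' ι' K)}
    {Y' : Set (Matrix κ' κ' K)} (h1X : 1 ∈ X) (h1Y : 1 ∈ Y)
    {P : Matrix (ι' ⊕ κ') (ι ⊕ κ) K} {P' : Matrix (ι ⊕ κ) (ι' ⊕ κ') K}
    {Q : Matrix (ι ⊕ κ) (ι' ⊕ κ') K} (hP : P' * P = 1)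
    (h : ∀ M ∈ upperJoin X Y, P * M * Q ∈ upperJoin X' Y')
    (hP' : ∀ v, P' *ᵥ Sum.elim v 0 ∈ firstBlock K ι κ) (v : ι' → K) :
    Q *ᵥ Sum.elim v 0 ∈ firstBlock K ι κ := by
  have h1 : (1 : Matrix (ι ⊕ κ) (ι ⊕ κ) K) ∈ upperJoin X Y := ⟨1, h1X, 1, h1Y, 0, by simp⟩
  have h2 : P *ᵥ (Q *ᵥ Sum.elim v 0) ∈ firstBlock K ι' κ' := fun j => by
    have := mulVec_apply_inr_of_mem_upperJoin (h 1 h1) v j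
    rwa [Matrix.mul_one, ← Matrix.mulVec_mulVec] at this
  have h3 : Q *ᵥ Sum.elim v 0 = P' *ᵥ (P *ᵥ (Q *ᵥ Sum.elim v 0)) := by
    rw [Matrix.mulVec_mulVec, hP, Matrix.one_mulVec]
  rw [h3, mem_firstBlock_iff.1 h2]
  exact hP' _

theorem blocks_mul_eq_one {α β : Type*} [DecidableEq α] [DecidableEq β]
    {P : Matrix (α ⊕ β) (ι ⊕ κ) K} {P' : Matrix (ι ⊕ κ) (α ⊕ β) K} (h : P * P' = 1)
    (hP : P.toBlocks₂₁ = 0) (hP' : P'.toBlocks₂₁ = 0) :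
    P.toBlocks₁₁ * P'.toBlocks₁₁ = 1 ∧ P.toBlocks₂₂ * P'.toBlocks₂₂ = 1 := by
  rw [← fromBlocks_toBlocks P, ← fromBlocks_toBlocks P', hP, hP', fromBlocks_multiply,
    ← fromBlocks_one, fromBlocks_inj] at h
  simpa using And.intro h.1 h.2.2.2

theorem fromBlocks_mul_upper_mul {α β : Type*} {P : Matrix (α ⊕ β) (ι ⊕ κ) K}
    {Q : Matrix (ι ⊕ κ) (α ⊕ β) K} (hP : P.toBlocks₂₁ = 0) (hQ : Q.toBlocks₂₁ = 0)
    (A : Matrix ι ι K) (B : Matrix ι κ K) (C : Matrix κ κ K) :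
    ∃ D, P * fromBlocks A B 0 C * Q =
      fromBlocks (P.toBlocks₁₁ * A * Q.toBlocks₁₁) D 0 (P.toBlocks₂₂ * C * Q.toBlocks₂₂) := by
  refine ⟨P.toBlocks₁₁ * A * Q.toBlocks₁₂ +
    (P.toBlocks₁₁ * B + P.toBlocks₁₂ * C) * Q.toBlocks₂₂, ?_⟩
  conv_lhs => rw [← fromBlocks_toBlocks P, ← fromBlocks_toBlocks Q, hP, hQ]
  simp only [fromBlocks_multiply, Matrix.mul_zero, Matrix.zero_mul, add_zero, zero_add]

theorem RectEquiv.of_upperJoin [DecidableEq ι] [DecidableEq κ] [DecidableEq ι'] [DecidableEq κ']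
    [Nonempty ι] [Nonempty ι'] {X : Set (Matrix ι ι K)}
    {Y : Set (Matrix κ κ K)} {X' : Set (Matrix ι' ι' K)} {Y' : Set (Matrix κ' κ' K)}
    (hX : SpansAll X) (hX' : SpansAll X') (h1X : 1 ∈ X) (h1X' : 1 ∈ X') (h1Y : 1 ∈ Y)
    (h1Y' : 1 ∈ Y') (h : RectEquiv (upperJoin X Y) (upperJoin X' Y')) :
    RectEquiv X X' ∧ RectEquiv Y Y' := by
  obtain ⟨P, P', Q, Q', h1, h2, h3, h4, h5⟩ := h
  have hto : ∀ M ∈ upperJoin X Y, P * M * Q ∈ upperJoin X' Y' := fun M hM =>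
    h5 ▸ ⟨M, hM, rfl⟩
  have hfrom : ∀ M ∈ upperJoin X' Y', P' * M * Q' ∈ upperJoin X Y := fun M hM => by
    rw [h5] at hM
    obtain ⟨N, hN, rfl⟩ := hM
    have : P' * (P * N * Q) * Q' = N := by
      rw [← Matrix.mul_assoc, ← Matrix.mul_assoc, h2, Matrix.one_mul, Matrix.mul_assoc, h3,
        Matrix.mul_one]
    exact this.symm ▸ hN
  have hP := left_mulVec_mem_firstBlock hX ⟨1, h1X⟩ ⟨1, h1Y⟩ h4 hto
  have hP' := left_mulVec_mem_firstBlock hX' ⟨1, h1X'⟩ ⟨1, h1Y'⟩ h3 hfrom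
  have hQ := toBlocks₂₁_eq_zero (right_mulVec_mem_firstBlock h1X h1Y h2 hto hP')
  have hQ' := toBlocks₂₁_eq_zero (right_mulVec_mem_firstBlock h1X' h1Y' h1 hfrom hP)
  replace hP := toBlocks₂₁_eq_zero hP
  replace hP' := toBlocks₂₁_eq_zero hP'
  have k1 := blocks_mul_eq_one h1 hP hP'
  have k2 := blocks_mul_eq_one h2 hP' hP
  have k3 := blocks_mul_eq_one h3 hQ hQ'
  have k4 := blocks_mul_eq_one h4 hQ' hQ
  refine ⟨⟨_, _, _, _, k1.1, k2.1, k3.1, k4.1, ?_⟩, ⟨_, _, _, _, k1.2, k2.2, k3.2, k4.2, ?_⟩⟩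
  · ext A'
    constructor
    · intro hA'
      have hM : fromBlocks A' 0 0 1 ∈ upperJoin X' Y' := ⟨A', hA', 1, h1Y', 0, rfl⟩
      rw [h5] at hM
      obtain ⟨_, ⟨A, hA, C, hC, B, rfl⟩, hN⟩ := hM
      obtain ⟨D, hD⟩ := fromBlocks_mul_upper_mul hP hQ A B C
      exact ⟨A, hA, (fromBlocks_inj.1 (hD.symm.trans hN)).1⟩
    · rintro ⟨A, hA, rfl⟩
      obtain ⟨A', hA', C', hC', B', hN⟩ := hto _ ⟨A, hA, 1, h1Y, 0, rfl⟩
      obtain ⟨D, hD⟩ := fromBlocks_mul_upper_mul hP hQ A 0 1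
      have := (fromBlocks_inj.1 (hD.symm.trans hN)).1
      dsimp only
      rwa [this]
  · ext C'
    constructor
    · intro hC'
      have hM : fromBlocks 1 0 0 C' ∈ upperJoin X' Y' := ⟨1, h1X', C', hC', 0, rfl⟩
      rw [h5] at hM
      obtain ⟨_, ⟨A, hA, C, hC, B, rfl⟩, hN⟩ := hM
      obtain ⟨D, hD⟩ := fromBlocks_mul_upper_mul hP hQ A B C
      exact ⟨C, hC, (fromBlocks_inj.1 (hD.symm.trans hN)).2.2.2⟩
    · rintro ⟨C, hC, rfl⟩
      obtain ⟨A', hA', C', hC', B', hN⟩ := hto _ ⟨1, h1X, C, hC, 0, rfl⟩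
      obtain ⟨D, hD⟩ := fromBlocks_mul_upper_mul hP hQ 1 0 C
      have := (fromBlocks_inj.1 (hD.symm.trans hN)).2.2.2
      dsimp only
      rwa [this]

theorem zero_mem_bdSet (l : List (Σ m : ℕ, Matrix (Fin m) (Fin m) K)) : 0 ∈ bdSet l := by
  induction l with
  | nil => trivial
  | cons x xs ih =>
    exact ⟨0, ⟨0, (altSubmodule K x.1).zero_mem, by simp⟩, 0, ih, 0, by
      rw [fromBlocks_zero]; rfl⟩

theorem one_mem_onePlus {α : Type*} [DecidableEq α] {X : Set (Matrix α α K)} (h : 0 ∈ X) :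
    1 ∈ onePlus X :=
  ⟨0, h, add_zero _⟩

theorem forall₂_qfSimilar_of_rectEquiv (l : List (Σ m : ℕ, Matrix (Fin m) (Fin m) K)) :
    ∀ l' : List (Σ m : ℕ, Matrix (Fin m) (Fin m) K),
      (∀ x ∈ l, 0 < x.1 ∧ IsUnit x.2 ∧ nonIsotropic x.2) →
      (∀ x ∈ l', 0 < x.1 ∧ IsUnit x.2 ∧ nonIsotropic x.2) →
      RectEquiv (onePlus (bdSet l)) (onePlus (bdSet l')) → List.Forall₂ qfSimilar l l' := by
  induction l with
  | nil =>
    intro l' _ hl' h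
    cases l' with
    | nil => exact List.Forall₂.nil
    | cons y ys =>
      have h1 := h.card_eq
      have h2 := (hl' y List.mem_cons_self).1
      rw [Fintype.card_fin, Fintype.card_fin] at h1
      simp only [sigSum] at h1
      omega
  | cons x xs ih =>
    intro l' hl hl' h
    cases l' with
    | nil =>
      have h1 := h.card_eq
      have h2 := (hl x List.mem_cons_self).1
      rw [Fintype.card_fin, Fintype.card_fin] at h1
      simp only [sigSum] at h1
      omega
    | cons y ys =>
      simp only [List.mem_cons, forall_eq_or_imp] at hl hl'
      obtain ⟨⟨hx0, hxu, hx⟩, hxs⟩ := hl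
      obtain ⟨⟨hy0, hyu, hy⟩, hys⟩ := hl'
      have : Nonempty (Fin x.1) := ⟨⟨0, hx0⟩⟩
      have : Nonempty (Fin y.1) := ⟨⟨0, hy0⟩⟩
      have hmem : ∀ z : Σ m : ℕ, Matrix (Fin m) (Fin m) K, 0 ∈ mulAlt z.2 := fun z =>
        ⟨0, (altSubmodule K z.1).zero_mem, Matrix.mul_zero _⟩
      obtain ⟨h1, h2⟩ := RectEquiv.of_upperJoin (spansAll_onePlus_mulAlt hx)
        (spansAll_onePlus_mulAlt hy) (one_mem_onePlus (hmem x)) (one_mem_onePlus (hmem y))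
        (one_mem_onePlus (zero_mem_bdSet xs)) (one_mem_onePlus (zero_mem_bdSet ys))
        (((rectEquiv_bdSet_cons x xs).trans h).trans (rectEquiv_bdSet_cons y ys).symm)
      exact List.Forall₂.cons (qfSimilar_of_rectEquiv hx0 hxu hyu h1) (ih ys hxs hys h2)

end Uniqueness

theorem exists_ne_zero_ne_one {K : Type*} [Field K] (hK : 3 ≤ Cardinal.mk K) :
    ∃ τ : K, τ ≠ 0 ∧ τ ≠ 1 := by
  by_contra! hcon
  have h1 : (Set.univ : Set K) ⊆ {0, 1} := fun x _ => by
    by_cases hx : x = 0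
    · exact Or.inl hx
    · exact Or.inr (hcon x hx)
  have h2 : Cardinal.mk K ≤ 2 := by
    rw [← Cardinal.mk_univ]
    exact (Cardinal.mk_le_mk_of_subset h1).trans (by
      rw [Cardinal.mk_insert (by simp), Cardinal.mk_singleton]; exact one_add_one_eq_two.le)
  exact absurd (hK.trans h2) (by norm_num)

/-- An affine space of invertible matrices is equivalent to one of the form `1 + V`. -/
theorem exists_rectEquiv_onePlus {K : Type*} [Field K] {n : ℕ} {M₀ : Matrix (Fin n) (Fin n) K}
    {V₀ : Submodule K (Matrix (Fin n) (Fin n) K)}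
    (hGL : ∀ M ∈ (fun M => M₀ + M) '' (V₀ : Set (Matrix (Fin n) (Fin n) K)), IsUnit M) :
    ∃ V : Submodule K (Matrix (Fin n) (Fin n) K), finrank K V = finrank K V₀ ∧
      (∀ M ∈ V, (1 + M).det ≠ 0) ∧
      RectEquiv (onePlus (V : Set (Matrix (Fin n) (Fin n) K)))
        ((fun M => M₀ + M) '' (V₀ : Set (Matrix (Fin n) (Fin n) K))) := by
  obtain ⟨⟨M₀, N, h1, h2⟩, rfl⟩ : IsUnit M₀ := hGL _ ⟨0, V₀.zero_mem, add_zero _⟩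
  dsimp only at *
  have hNM : ∀ M, M₀ * (1 + N * M) = M₀ + M := fun M => by
    rw [Matrix.mul_add, Matrix.mul_one, ← Matrix.mul_assoc, h1, Matrix.one_mul]
  have hinj : Function.Injective (LinearMap.mulLeft K N) := fun A B h => by
    have : M₀ * (N * A) = M₀ * (N * B) := congrArg (M₀ * ·) h
    rwa [← Matrix.mul_assoc, ← Matrix.mul_assoc, h1, Matrix.one_mul, Matrix.one_mul] at this
  refine ⟨V₀.map (LinearMap.mulLeft K N), ?_, ?_, M₀, N, 1, 1, h1, h2, by simp, by simp, ?_⟩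
  · exact (Submodule.equivMapOfInjective (LinearMap.mulLeft K N) hinj V₀).finrank_eq.symm
  · rintro _ ⟨M, hM, rfl⟩
    have := det_ne_zero_of_isUnit (hGL _ ⟨M, hM, rfl⟩)
    dsimp only at this
    rw [← hNM, Matrix.det_mul] at this
    exact right_ne_zero_of_mul this
  · ext M
    constructor
    · rintro ⟨A, hA, rfl⟩
      exact ⟨_, ⟨_, ⟨A, hA, rfl⟩, rfl⟩, by simpa using hNM A⟩
    · rintro ⟨_, ⟨_, ⟨A, hA, rfl⟩, rfl⟩, rfl⟩
      exact ⟨A, hA, by simpa using (hNM A).symm⟩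

end AffineNonsingular

/-- Classification theorem for `n(n-1)/2`-dimensional affine subspaces of non-singular
matrices.  Assume `|K| ≥ 3` and let `𝒱` be an affine subspace of `M_n(K)` of dimension
`n(n-1)/2` consisting of invertible matrices.  Then: (1) `𝒱` is equivalent to
`I_n + (P_1·Alt_{n_1}(K) ∨ ⋯ ∨ P_p·Alt_{n_p}(K))` for non-isotropic invertible `P_k`;
(2) the number `p` of blocks and the similarity classes of the quadratic forms
`X ↦ Xᵀ P_k X` are uniquely determined by `𝒱`; (3) conversely, replacing each `P_k` by
any non-isotropic invertible `Q_k` with similar quadratic form again yields an affine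
space equivalent to `𝒱`. -/
theorem classification_affine_nonsingular (K : Type*) [Field K] (hK : 3 ≤ Cardinal.mk K)
    (n : ℕ) (𝒱 : Set (Matrix (Fin n) (Fin n) K))
    (haff : ∃ (M₀ : Matrix (Fin n) (Fin n) K) (V₀ : Submodule K (Matrix (Fin n) (Fin n) K)),
      Module.finrank K V₀ = n * (n - 1) / 2 ∧
      𝒱 = (fun M => M₀ + M) '' (V₀ : Set (Matrix (Fin n) (Fin n) K)))
    (hGL : ∀ M ∈ 𝒱, IsUnit M) :
    (∃ l : List (Σ m : ℕ, Matrix (Fin m) (Fin m) K), AffRepresents 𝒱 l) ∧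
    (∀ l l' : List (Σ m : ℕ, Matrix (Fin m) (Fin m) K),
      AffRepresents 𝒱 l → AffRepresents 𝒱 l' → List.Forall₂ qfSimilar l l') ∧
    (∀ l l' : List (Σ m : ℕ, Matrix (Fin m) (Fin m) K),
      AffRepresents 𝒱 l → (∀ x ∈ l', IsUnit x.2 ∧ nonIsotropic x.2) →
      List.Forall₂ qfSimilar l l' →
      ∃ h : sigSum l' = n,
        EquivSets ((fun M => 1 + M) ''
          ((Matrix.reindex (finCongr h) (finCongr h)) '' bdSet l')) 𝒱) := by
  obtain ⟨M₀, V₀, hdim, rfl⟩ := haff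
  refine ⟨?_, fun l l' h h' => ?_, fun l l' h hl' hll' => ?_⟩
  · obtain ⟨τ, hτ0, hτ1⟩ := AffineNonsingular.exists_ne_zero_ne_one hK
    obtain ⟨V, hV, hdet, hVe⟩ := AffineNonsingular.exists_rectEquiv_onePlus hGL
    obtain ⟨l, hl, hle⟩ := AffineNonsingular.exists_rectEquiv_bdSet hτ0 hτ1 n V hdet
      (by rw [hV, hdim, Nat.choose_two_right])
    exact ⟨l, AffineNonsingular.affRepresents_iff.2 ⟨hl, hle.trans hVe⟩⟩
  · obtain ⟨hl, he⟩ := AffineNonsingular.affRepresents_iff.1 h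
    obtain ⟨hl', he'⟩ := AffineNonsingular.affRepresents_iff.1 h'
    exact AffineNonsingular.forall₂_qfSimilar_of_rectEquiv l l' hl hl' (he.trans he'.symm)
  · obtain ⟨hl, he⟩ := AffineNonsingular.affRepresents_iff.1 h
    have he' := (AffineNonsingular.rectEquiv_bdSet hll' (fun x hx => (hl x hx).2.1)
      (fun x hx => (hl' x hx).1)).symm.trans he
    have hn : sigSum l' = n := by simpa using he'.card_eq
    exact ⟨hn, AffineNonsingular.rectEquiv_iff_equivSets.1
      ((AffineNonsingular.rectEquiv_onePlus_reindex (finCongr hn) _).symm.trans he')⟩
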